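/- arXiv:2104.06380 — 12 statements merged into one kernel-verified Lean document; each statement's English description precedes it below -/
import Mathlib

section
/- Let X and Y be finite index sets, let A be a complex matrix with rows indexed by X and columns indexed by Y, and let ℛ be a partition of X × Y into combinatorial rectangles. For each R ∈ ℛ let A_R be the matrix that agrees with A on entries (x,y) ∈ R and is 0 elsewhere. Then ‖A‖² ≤ Σ_{R ∈ ℛ} ‖A_R‖². -/
/-- The spectral norm (largest singular value) of a complex matrix,
defined as the operator norm of the associated linear map between
Euclidean spaces. -/
noncomputable def specNorm {X Y : Type*} [Fintype X] [Fintype Y] [DecidableEq Y]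
    (A : Matrix X Y ℂ) : ℝ :=
  ‖LinearMap.toContinuousLinearMap (Matrix.toEuclideanLin A)‖

open scoped Classical

open scoped InnerProductSpace

/-- The vector that agrees with `u` on `s` and vanishes elsewhere. -/
noncomputable def EuclideanSpace.restrictTo {X : Type*} (s : Set X) (u : EuclideanSpace ℂ X) :
    EuclideanSpace ℂ X :=
  WithLp.toLp 2 (s.indicator u)

theorem EuclideanSpace.norm_sq_restrictTo {X : Type*} [Fintype X] (s : Set X)
    (u : EuclideanSpace ℂ X) :
    ‖u.restrictTo s‖ ^ 2 = ∑ x, if x ∈ s then ‖u x‖ ^ 2 else 0 := by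
  rw [EuclideanSpace.norm_sq_eq]
  refine Finset.sum_congr rfl fun x _ => ?_
  by_cases hx : x ∈ s <;> simp [restrictTo, hx]

theorem specNorm_nonneg {X Y : Type*} [Fintype X] [Fintype Y] [DecidableEq Y]
    (A : Matrix X Y ℂ) : 0 ≤ specNorm A :=
  norm_nonneg _

theorem inner_toEuclideanLin_eq_sum {X Y : Type*} [Fintype X] [Fintype Y] [DecidableEq Y]
    (A : Matrix X Y ℂ) (u : EuclideanSpace ℂ X) (v : EuclideanSpace ℂ Y) :
    ⟪u, Matrix.toEuclideanLin A v⟫_ℂ = ∑ x, ∑ y, A x y * v y * star (u x) := by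
  simp [PiLp.inner_apply, Matrix.toLpLin_apply, Matrix.mulVec, dotProduct,
    Finset.sum_mul]

theorem norm_inner_toEuclideanLin_le {X Y : Type*} [Fintype X] [Fintype Y] [DecidableEq Y]
    (A : Matrix X Y ℂ) (u : EuclideanSpace ℂ X) (v : EuclideanSpace ℂ Y) :
    ‖⟪u, Matrix.toEuclideanLin A v⟫_ℂ‖ ≤ specNorm A * (‖u‖ * ‖v‖) := by
  have h := (LinearMap.toContinuousLinearMap (Matrix.toEuclideanLin A)).le_opNorm v
  calc ‖⟪u, Matrix.toEuclideanLin A v⟫_ℂ‖ ≤ ‖u‖ * ‖Matrix.toEuclideanLin A v‖ :=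
        norm_inner_le_norm _ _
    _ ≤ ‖u‖ * (specNorm A * ‖v‖) := by gcongr; exact h
    _ = specNorm A * (‖u‖ * ‖v‖) := by ring

/-- A bound on the bilinear form of a matrix yields a bound on its spectral norm. -/
theorem specNorm_sq_le_of_norm_inner_sq_le {X Y : Type*} [Fintype X] [Fintype Y] [DecidableEq Y]
    (A : Matrix X Y ℂ) {S : ℝ} (hS : 0 ≤ S)
    (h : ∀ u v, ‖⟪u, Matrix.toEuclideanLin A v⟫_ℂ‖ ^ 2 ≤ S * (‖u‖ ^ 2 * ‖v‖ ^ 2)) :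
    specNorm A ^ 2 ≤ S := by
  refine (Real.le_sqrt (specNorm_nonneg A) hS).1 ?_
  refine ContinuousLinearMap.opNorm_le_of_re_inner_le (𝕜 := ℂ) (Real.sqrt_nonneg S)
    fun v u hv hu => (RCLike.re_le_norm _).trans ?_
  rw [norm_inner_symm]
  exact Real.le_sqrt_of_sq_le (by simpa [hu, hv] using h u v)

/-- A double sum over `X × Y` splits into the sums over the parts of a partition. -/
theorem sum_sum_eq_sum_rectangle {X Y ι M : Type*} [Fintype X] [Fintype Y] [Fintype ι]
    [AddCommMonoid M] {R : ι → Set X} {C : ι → Set Y}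
    (hdisj : ∀ i j, i ≠ j → Disjoint (R i ×ˢ C i) (R j ×ˢ C j))
    (hcover : (⋃ i, R i ×ˢ C i) = Set.univ) (f : X → Y → M) :
    ∑ x, ∑ y, f x y = ∑ i, ∑ x, ∑ y, if x ∈ R i ∧ y ∈ C i then f x y else 0 := by
  symm
  rw [Finset.sum_comm]
  refine Finset.sum_congr rfl fun x _ => ?_
  rw [Finset.sum_comm]
  refine Finset.sum_congr rfl fun y _ => ?_
  obtain ⟨i, hi⟩ := Set.mem_iUnion.1 (hcover ▸ Set.mem_univ (x, y))
  rw [Finset.sum_eq_single i]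
  · exact if_pos hi
  · exact fun j _ hj => if_neg fun hxy => Set.disjoint_left.1 (hdisj j i hj) hxy hi
  · simp

/-- If `A` is a complex matrix indexed by finite sets `X`, `Y`, and `X × Y` is
partitioned into combinatorial rectangles `R i ×ˢ C i`, then the square of the
spectral norm of `A` is at most the sum over the rectangles of the squares of
the spectral norms of the restrictions of `A` to the rectangles. -/
theorem spectral_norm_squared_subadditive_over_rectangles
    {X Y : Type*} [Fintype X] [Fintype Y] [DecidableEq X] [DecidableEq Y]
    (A : Matrix X Y ℂ)
    {ι : Type*} [Fintype ι]
    (R : ι → Set X) (C : ι → Set Y)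
    (hdisj : ∀ i j, i ≠ j → Disjoint (R i ×ˢ C i) (R j ×ˢ C j))
    (hcover : (⋃ i, R i ×ˢ C i) = Set.univ) :
    specNorm A ^ 2 ≤
      ∑ i : ι, specNorm
        (Matrix.of fun x y => if x ∈ R i ∧ y ∈ C i then A x y else 0) ^ 2 := by
  refine specNorm_sq_le_of_norm_inner_sq_le A (Finset.sum_nonneg fun i _ => sq_nonneg _) fun u v => ?_
  set B : ι → Matrix X Y ℂ :=
    fun i => Matrix.of fun x y => if x ∈ R i ∧ y ∈ C i then A x y else 0 with hB
  have hinner : ⟪u, Matrix.toEuclideanLin A v⟫_ℂ =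
      ∑ i, ⟪u.restrictTo (R i), Matrix.toEuclideanLin (B i) (v.restrictTo (C i))⟫_ℂ := by
    simp only [inner_toEuclideanLin_eq_sum]
    rw [sum_sum_eq_sum_rectangle hdisj hcover]
    refine Finset.sum_congr rfl fun i _ => Finset.sum_congr rfl fun x _ =>
      Finset.sum_congr rfl fun y _ => ?_
    by_cases hx : x ∈ R i <;> by_cases hy : y ∈ C i <;>
      simp [hB, EuclideanSpace.restrictTo, hx, hy]
  have hnorm : ∑ i, (‖u.restrictTo (R i)‖ * ‖v.restrictTo (C i)‖) ^ 2 =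
      ‖u‖ ^ 2 * ‖v‖ ^ 2 := by
    simp only [mul_pow, EuclideanSpace.norm_sq_restrictTo, Finset.sum_mul_sum]
    rw [EuclideanSpace.norm_sq_eq, EuclideanSpace.norm_sq_eq, Finset.sum_mul_sum,
      sum_sum_eq_sum_rectangle hdisj hcover]
    refine Finset.sum_congr rfl fun i _ => Finset.sum_congr rfl fun x _ =>
      Finset.sum_congr rfl fun y _ => ?_
    by_cases hx : x ∈ R i <;> by_cases hy : y ∈ C i <;> simp [hx, hy]
  calc ‖⟪u, Matrix.toEuclideanLin A v⟫_ℂ‖ ^ 2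
      ≤ (∑ i, specNorm (B i) * (‖u.restrictTo (R i)‖ * ‖v.restrictTo (C i)‖)) ^ 2 := by
        rw [hinner]
        gcongr
        exact norm_sum_le_of_le _ fun i _ => norm_inner_toEuclideanLin_le _ _ _
    _ ≤ (∑ i, specNorm (B i) ^ 2) *
          ∑ i, (‖u.restrictTo (R i)‖ * ‖v.restrictTo (C i)‖) ^ 2 :=
        Finset.sum_mul_sq_le_sq_mul_sq _ _ _
    _ = (∑ i, specNorm (B i) ^ 2) * (‖u‖ ^ 2 * ‖v‖ ^ 2) := by rw [hnorm]
end

section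
/- Let f : {0,1}^n → {0,1}, and let A be a nonzero complex matrix with rows indexed by f⁻¹(0) and columns indexed by f⁻¹(1). For i ∈ [n], let A_i be the matrix with ⟨x|A_i|y⟩ = ⟨x|A|y⟩ if x_i ≠ y_i and 0 otherwise. Suppose f⁻¹(0) × f⁻¹(1) is partitioned into N combinatorial rectangles, each of which is monochromatic, i.e., for each rectangle R there exists a coordinate i ∈ [n] with x_i ≠ y_i for all (x,y) ∈ R. Then ‖A‖² ≤ N · max_{i ∈ [n]} ‖A_i‖². -/
open scoped Classical

/-- The bilinear form of a matrix is bounded by its spectral norm. -/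
lemma norm_sum_star_mul_mul_le_specNorm {X Y : Type*} [Fintype X] [Fintype Y] [DecidableEq Y]
    (B : Matrix X Y ℂ) (u : EuclideanSpace ℂ X) (v : EuclideanSpace ℂ Y) :
    ‖∑ x, ∑ y, star (u x) * B x y * v y‖ ≤ specNorm B * (‖u‖ * ‖v‖) := by
  have key : ∑ x, ∑ y, star (u x) * B x y * v y = inner ℂ u (Matrix.toEuclideanLin B v) := by
    simp only [PiLp.inner_apply, RCLike.inner_apply, Matrix.toLpLin_apply, Matrix.mulVec,
      dotProduct, Finset.sum_mul, starRingEnd_apply]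
    exact Finset.sum_congr rfl fun x _ => Finset.sum_congr rfl fun y _ => by ring
  rw [key]
  calc ‖inner ℂ u (Matrix.toEuclideanLin B v)‖
      ≤ ‖u‖ * ‖Matrix.toEuclideanLin B v‖ := norm_inner_le_norm _ _
    _ ≤ ‖u‖ * (specNorm B * ‖v‖) := by
        gcongr
        exact (LinearMap.toContinuousLinearMap (Matrix.toEuclideanLin B)).le_opNorm v
    _ = specNorm B * (‖u‖ * ‖v‖) := by ring

/-- A double sum splits along a partition of the index set into rectangles. -/
lemma sum_rectangle_partition {X Y ι M : Type*} [Fintype X] [Fintype Y] [Fintype ι]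
    [AddCommMonoid M]
    (R : ι → Set X) (C : ι → Set Y) (hpart : ∀ x y, ∃! r, x ∈ R r ∧ y ∈ C r) (F : X → Y → M) :
    ∑ r, ∑ x, ∑ y, (if x ∈ R r ∧ y ∈ C r then F x y else 0) = ∑ x, ∑ y, F x y := by
  rw [Finset.sum_comm]
  refine Finset.sum_congr rfl fun x _ => ?_
  rw [Finset.sum_comm]
  refine Finset.sum_congr rfl fun y _ => ?_
  obtain ⟨r, hr, hu⟩ := hpart x y
  rw [Finset.sum_eq_single r (fun s _ hs => if_neg fun h => hs (hu s h)) (by simp), if_pos hr]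

/-- If the entries are partitioned into rectangles, and on each rectangle `A` agrees with a matrix
of squared spectral norm at most `M`, then `‖A‖²` is at most `M` times the number of rectangles. -/
lemma specNorm_sq_le_card_mul {X Y ι : Type*} [Fintype X] [Fintype Y] [DecidableEq Y]
    [Fintype ι] (A : Matrix X Y ℂ)
    (R : ι → Set X) (C : ι → Set Y) (hpart : ∀ x y, ∃! r, x ∈ R r ∧ y ∈ C r)
    (B : ι → Matrix X Y ℂ) (hB : ∀ r, ∀ x ∈ R r, ∀ y ∈ C r, B r x y = A x y)
    {M : ℝ} (hM : 0 ≤ M) (hBM : ∀ r, specNorm (B r) ^ 2 ≤ M) :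
    specNorm A ^ 2 ≤ Fintype.card ι * M := by
  have hbound : specNorm A ≤ √(Fintype.card ι * M) := by
    refine ContinuousLinearMap.opNorm_le_bound _ (Real.sqrt_nonneg _) fun v => ?_
    rw [LinearMap.coe_toContinuousLinearMap']
    set w := Matrix.toEuclideanLin A v with hw
    let wR : ι → EuclideanSpace ℂ X := fun r => WithLp.toLp 2 fun x => if x ∈ R r then w x else 0
    let vC : ι → EuclideanSpace ℂ Y := fun r => WithLp.toLp 2 fun y => if y ∈ C r then v y else 0
    have hsq : ∑ r, (‖wR r‖ * ‖vC r‖) ^ 2 = (‖w‖ * ‖v‖) ^ 2 := by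
      simp only [mul_pow, EuclideanSpace.norm_sq_eq, Finset.sum_mul_sum]
      rw [← sum_rectangle_partition R C hpart]
      refine Finset.sum_congr rfl fun r _ => Finset.sum_congr rfl fun x _ =>
        Finset.sum_congr rfl fun y _ => ?_
      by_cases hx : x ∈ R r <;> by_cases hy : y ∈ C r <;> simp [wR, vC, hx, hy]
    have hsum : ∑ x, ∑ y, star (w x) * A x y * v y =
        ∑ r, ∑ x, ∑ y, star (wR r x) * B r x y * vC r y := by
      rw [← sum_rectangle_partition R C hpart]
      refine Finset.sum_congr rfl fun r _ => Finset.sum_congr rfl fun x _ =>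
        Finset.sum_congr rfl fun y _ => ?_
      by_cases hx : x ∈ R r <;> by_cases hy : y ∈ C r <;> simp [wR, vC, hx, hy]
      exact .inl (.inl (hB r x hx y hy).symm)
    have hinner : ∑ x, ∑ y, star (w x) * A x y * v y = inner ℂ w w := by
      conv_rhs => rw [hw]
      simp only [PiLp.inner_apply, RCLike.inner_apply, ← hw, starRingEnd_apply]
      refine Finset.sum_congr rfl fun x _ => ?_
      have hwx : w x = ∑ y, A x y * v y := rfl
      conv_rhs => rw [mul_comm]
      rw [hwx, Finset.mul_sum]
      exact Finset.sum_congr rfl fun y _ => by ring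
    have hle : ‖w‖ ^ 2 ≤ √M * ∑ r, ‖wR r‖ * ‖vC r‖ := by
      have : ‖w‖ ^ 2 = ‖(inner ℂ w w : ℂ)‖ := by
        rw [inner_self_eq_norm_sq_to_K]; simp
      rw [this, ← hinner, hsum, Finset.mul_sum]
      refine (norm_sum_le _ _).trans (Finset.sum_le_sum fun r _ => ?_)
      refine (norm_sum_star_mul_mul_le_specNorm _ _ _).trans ?_
      gcongr
      exact Real.le_sqrt_of_sq_le (hBM r)
    have hcs : ∑ r, ‖wR r‖ * ‖vC r‖ ≤ √(Fintype.card ι) * (‖w‖ * ‖v‖) := by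
      rw [← Real.sqrt_sq (by positivity : 0 ≤ ‖w‖ * ‖v‖), ← Real.sqrt_mul (by positivity), ← hsq]
      exact Real.le_sqrt_of_sq_le sq_sum_le_card_mul_sum_sq
    rcases (norm_nonneg w).eq_or_lt with h0 | h0
    · rw [← h0]; positivity
    · refine le_of_mul_le_mul_left ?_ h0
      calc ‖w‖ * ‖w‖ = ‖w‖ ^ 2 := by ring
        _ ≤ √M * (√(Fintype.card ι) * (‖w‖ * ‖v‖)) := hle.trans (by gcongr)
        _ = ‖w‖ * (√(Fintype.card ι * M) * ‖v‖) := by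
          rw [Real.sqrt_mul (by positivity)]; ring
  calc specNorm A ^ 2 ≤ √(Fintype.card ι * M) ^ 2 := by
        gcongr
        exact norm_nonneg _
    _ = Fintype.card ι * M := Real.sq_sqrt (by positivity)

/-- If `A` is a nonzero complex matrix with rows indexed by `f⁻¹(0)` and columns
indexed by `f⁻¹(1)`, and `f⁻¹(0) × f⁻¹(1)` is partitioned into `N` monochromatic
combinatorial rectangles, then `‖A‖² ≤ N · max_i ‖A_i‖²`, where `A_i` keeps only
the entries `(x, y)` with `x i ≠ y i`. -/
theorem specNorm_sq_le_rectangle_partition_mul_max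
    {n : ℕ} (f : (Fin n → Bool) → Bool)
    (A : Matrix {x : Fin n → Bool // f x = false} {y : Fin n → Bool // f y = true} ℂ)
    (hA : A ≠ 0)
    (N : ℕ)
    (R : Fin N → Set {x : Fin n → Bool // f x = false})
    (C : Fin N → Set {y : Fin n → Bool // f y = true})
    (hdisj : ∀ r r', r ≠ r' → Disjoint (R r ×ˢ C r) (R r' ×ˢ C r'))
    (hcover : (⋃ r, R r ×ˢ C r) = Set.univ)
    (hmono : ∀ r : Fin N, ∃ i : Fin n, ∀ x ∈ R r, ∀ y ∈ C r, x.1 i ≠ y.1 i) :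
    specNorm A ^ 2 ≤
      N * ⨆ i : Fin n,
        specNorm (Matrix.of fun x y => if x.1 i ≠ y.1 i then A x y else 0) ^ 2 := by
  choose i hi using hmono
  have hpart : ∀ x y, ∃! r, x ∈ R r ∧ y ∈ C r := fun x y => by
    obtain ⟨r, hr⟩ := Set.mem_iUnion.1 (hcover ▸ Set.mem_univ (x, y))
    exact ⟨r, hr, fun s hs => by_contra fun hne => Set.disjoint_left.1 (hdisj s r hne) hs hr⟩
  have h := specNorm_sq_le_card_mul A R C hpart
    (fun r => Matrix.of fun x y => if x.1 (i r) ≠ y.1 (i r) then A x y else 0)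
    (fun r x hx y hy => if_pos (hi r x hx y hy))
    (Real.iSup_nonneg fun _ => sq_nonneg _)
    (fun r => le_ciSup (f := fun i : Fin n =>
      specNorm (Matrix.of fun x y => if x.1 i ≠ y.1 i then A x y else 0) ^ 2)
      (Set.finite_range _).bddAbove (i r))
  rwa [Fintype.card_fin] at h
end

section
/- Let f : {0,1}^n → {0,1}, let Γ be a 2^n × 2^n Hermitian matrix, and define the (n·2^n) × (n·2^n) matrix G by ⟨x,i|G|y,j⟩ = ⟨x|Γ|y⟩ if i = j and 0 otherwise (indices x,y ∈ {0,1}^n, i,j ∈ [n]). Let V be the diagonal unitary with V|x,i⟩ = (−1)^{x_i}|x,i⟩. Let ρ be any positive semidefinite (n·2^n) × (n·2^n) matrix with trace 1. Then Tr(Gρ) − Tr(G V ρ V*) ≤ 2 · max_{i ∈ [n]} ‖Γ ∘ D_i‖. -/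
open scoped Matrix ComplexOrder

open scoped Classical

open scoped MatrixOrder Matrix.Norms.L2Operator in
/-- Pairing a matrix with a positive semidefinite matrix under the trace is bounded by the
spectral norm times the trace. -/
theorem re_trace_mul_le_specNorm_mul_trace {X : Type*} [Fintype X] [DecidableEq X]
    (M ρ : Matrix X X ℂ) (hρ : ρ.PosSemidef) :
    (M * ρ).trace.re ≤ specNorm M * ρ.trace.re := by
  obtain ⟨B, rfl⟩ : ∃ B : Matrix X X ℂ, ρ = Bᴴ * B :=
    CStarAlgebra.nonneg_iff_eq_star_mul_self.mp hρ.nonneg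
  let w : X → EuclideanSpace ℂ X := fun k => WithLp.toLp 2 fun y => star (B k y)
  have trace_eq_sum_inner : ∀ N : Matrix X X ℂ,
      (N * (Bᴴ * B)).trace = ∑ k, inner ℂ (w k) (Matrix.toEuclideanLin N (w k)) := by
    intro N
    rw [← Matrix.mul_assoc, Matrix.trace_mul_comm, Matrix.trace]
    refine Finset.sum_congr rfl fun k _ => ?_
    simp [w, Matrix.mul_apply, PiLp.inner_apply, Matrix.mulVec, dotProduct,
      Matrix.toLpLin_apply, mul_comm]
  have trace_eq_sum_norm : (Bᴴ * B).trace.re = ∑ k, ‖w k‖ ^ 2 := by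
    have h := trace_eq_sum_inner 1
    rw [Matrix.one_mul] at h
    rw [h, Complex.re_sum]
    refine Finset.sum_congr rfl fun k _ => ?_
    rw [← inner_self_eq_norm_sq (𝕜 := ℂ) (w k)]
    simp
  rw [trace_eq_sum_inner, trace_eq_sum_norm, Complex.re_sum, Finset.mul_sum]
  refine Finset.sum_le_sum fun k _ => ?_
  calc (inner ℂ (w k) (Matrix.toEuclideanLin M (w k))).re
      ≤ ‖w k‖ * ‖Matrix.toEuclideanLin M (w k)‖ := re_inner_le_norm (𝕜 := ℂ) _ _
    _ ≤ ‖w k‖ * (specNorm M * ‖w k‖) := by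
        gcongr
        exact (LinearMap.toContinuousLinearMap (Matrix.toEuclideanLin M)).le_opNorm (w k)
    _ = specNorm M * ‖w k‖ ^ 2 := by ring

/-- One quantum query changes the progress measure by at most
`2 · max_i ‖Γ ∘ D_i‖`: for the block-diagonal matrix `G = Γ ⊗ I`, the phase-query
diagonal unitary `V`, and any density matrix `ρ`,
`Tr(Gρ) − Tr(GVρV*) ≤ 2 max_i ‖Γ ∘ D_i‖`. -/
theorem progress_measure_step_bound
    {n : ℕ} (f : (Fin n → Bool) → Bool)
    (Γ : Matrix (Fin n → Bool) (Fin n → Bool) ℂ) (hHerm : Γ.IsHermitian)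
    (G : Matrix ((Fin n → Bool) × Fin n) ((Fin n → Bool) × Fin n) ℂ)
    (hG : ∀ x i y j, G (x, i) (y, j) = if i = j then Γ x y else 0)
    (V : Matrix ((Fin n → Bool) × Fin n) ((Fin n → Bool) × Fin n) ℂ)
    (hV : V = Matrix.diagonal fun p => if p.1 p.2 then (-1 : ℂ) else 1)
    (ρ : Matrix ((Fin n → Bool) × Fin n) ((Fin n → Bool) × Fin n) ℂ)
    (hρ : ρ.PosSemidef) (hTr : ρ.trace = 1) :
    (Matrix.trace (G * ρ)).re - (Matrix.trace (G * V * ρ * Vᴴ)).re ≤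
      2 * ⨆ i : Fin n,
        specNorm (Matrix.of fun x y => if x i ≠ y i then Γ x y else 0) := by
  set D : Fin n → Matrix (Fin n → Bool) (Fin n → Bool) ℂ :=
    fun i => Matrix.of fun x y => if x i ≠ y i then Γ x y else 0
  let R : Fin n → Matrix (Fin n → Bool) (Fin n → Bool) ℂ :=
    fun i => ρ.submatrix (fun x => (x, i)) (fun x => (x, i))
  have trace_diff : (G * ρ).trace - (G * V * ρ * Vᴴ).trace = 2 * ∑ i, (D i * R i).trace := by
    subst hV
    simp only [Matrix.diagonal_conjTranspose, Matrix.trace, Matrix.diag_apply,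
      Matrix.mul_diagonal, Matrix.mul_apply (N := ρ), Fintype.sum_prod_type, hG]
    rw [Finset.sum_comm, Finset.sum_comm (s := Finset.univ (α := Fin n → Bool)),
      ← Finset.sum_sub_distrib, Finset.mul_sum]
    refine Finset.sum_congr rfl fun i _ => ?_
    rw [← Finset.sum_sub_distrib, Finset.mul_sum]
    refine Finset.sum_congr rfl fun x _ => ?_
    rw [Matrix.mul_apply, Finset.sum_mul, ← Finset.sum_sub_distrib, Finset.mul_sum]
    refine Finset.sum_congr rfl fun y _ => ?_
    simp only [ite_mul, zero_mul, Finset.sum_ite_eq, Finset.mem_univ, if_true, D, R,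
      Matrix.of_apply, Matrix.submatrix_apply]
    rcases Bool.eq_false_or_eq_true (x i) with hx | hx <;>
      rcases Bool.eq_false_or_eq_true (y i) with hy | hy <;> simp [hx, hy] <;> ring
  have trace_blocks : ∑ i, (R i).trace.re = 1 := by
    have h : ∑ i, (R i).trace = ρ.trace := by
      simp only [Matrix.trace, Matrix.diag_apply, Fintype.sum_prod_type, R,
        Matrix.submatrix_apply]
      exact Finset.sum_comm
    rw [← Complex.re_sum, h, hTr, Complex.one_re]
  have hR : ∀ i, (R i).PosSemidef := fun i => hρ.submatrix _
  have block_bound : ∀ i, (D i * R i).trace.re ≤ (⨆ j, specNorm (D j)) * (R i).trace.re :=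
    fun i => (re_trace_mul_le_specNorm_mul_trace (D i) (R i) (hR i)).trans <|
      mul_le_mul_of_nonneg_right
        (le_ciSup (f := fun j => specNorm (D j)) (Set.finite_range _).bddAbove i)
        (Complex.le_def.mp (hR i).trace_nonneg).1
  calc (G * ρ).trace.re - (G * V * ρ * Vᴴ).trace.re
      = 2 * ∑ i, (D i * R i).trace.re := by
        rw [← Complex.sub_re, trace_diff, ← Complex.re_sum]
        simp
    _ ≤ 2 * ∑ i, (⨆ j, specNorm (D j)) * (R i).trace.re := by
        gcongr with i
        exact block_bound i
    _ = 2 * ⨆ i, specNorm (D i) := by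
        rw [← Finset.mul_sum, trace_blocks, mul_one]
end

section
/- (Jordan's Lemma.) Let H be a finite-dimensional complex inner product space and let P and Q be orthogonal projections on H. Then H decomposes as an orthogonal direct sum of subspaces, each of dimension at most 2, each invariant under both P and Q, and such that on each two-dimensional subspace in the decomposition the restrictions of P and Q are rank-one orthogonal projections. -/
open scoped ComplexInnerProductSpace

/-- A subspace of dimension at most two, invariant under `P` and `Q`, on which `P` and `Q` have
rank one when the dimension is two. -/
structure IsJordanBlock {K E : Type*} [Field K] [AddCommGroup E] [Module K E]
    (P Q : E →ₗ[K] E) (V : Submodule K E) : Prop where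
  finrank_le : Module.finrank K V ≤ 2
  map_left_le : V.map P ≤ V
  map_right_le : V.map Q ≤ V
  finrank_map : Module.finrank K V = 2 →
    Module.finrank K (V.map P) = 1 ∧ Module.finrank K (V.map Q) = 1

section Block

variable {K E : Type*} [Field K] [AddCommGroup E] [Module K E] {P Q : E →ₗ[K] E}

lemma finrank_span_singleton_le_one (v : E) : Module.finrank K (K ∙ v) ≤ 1 := by
  simpa using finrank_span_le_card (R := K) ({v} : Set E)

lemma finrank_span_pair_le_two (v w : E) : Module.finrank K (Submodule.span K {v, w}) ≤ 2 := by
  classical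
  have h := finrank_span_finset_le_card (R := K) ({v, w} : Finset E)
  rw [Finset.coe_pair] at h
  exact h.trans Finset.card_le_two

lemma isJordanBlock_span_singleton {v : E} {a b : K} (hP : P v = a • v) (hQ : Q v = b • v) :
    IsJordanBlock P Q (K ∙ v) where
  finrank_le := (finrank_span_singleton_le_one v).trans one_le_two
  map_left_le := by
    rw [Submodule.map_span_le]
    rintro _ rfl
    exact hP ▸ Submodule.smul_mem _ _ (Submodule.mem_span_singleton_self _)
  map_right_le := by
    rw [Submodule.map_span_le]
    rintro _ rfl
    exact hQ ▸ Submodule.smul_mem _ _ (Submodule.mem_span_singleton_self _)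
  finrank_map h := by
    have := finrank_span_singleton_le_one (K := K) v
    omega

/-- If `v` is fixed by `P` and is an eigenvector of `P ∘ Q`, then `v` and `Q v` span a block. -/
lemma isJordanBlock_span_pair (hQ : ∀ x, Q (Q x) = Q x) {v : E} (hv : v ≠ 0) {c : K}
    (hPv : P v = v) (hPQ : P (Q v) = c • v) : IsJordanBlock P Q (Submodule.span K {v, Q v}) := by
  have hmapP : (Submodule.span K {v, Q v}).map P = K ∙ v := by
    rw [Submodule.map_span, Set.image_pair, hPv, hPQ, Set.pair_comm]
    exact Submodule.span_insert_eq_span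
      (Submodule.smul_mem _ _ (Submodule.mem_span_singleton_self _))
  have hmapQ : (Submodule.span K {v, Q v}).map Q = K ∙ Q v := by
    rw [Submodule.map_span, Set.image_pair, hQ, Set.pair_eq_singleton]
  refine ⟨?_, ?_, ?_, fun h ↦ ?_⟩
  · exact finrank_span_pair_le_two v (Q v)
  · rw [hmapP]
    exact Submodule.span_mono (by simp)
  · rw [hmapQ]
    exact Submodule.span_mono (by simp)
  · rw [hmapP, hmapQ]
    refine ⟨finrank_span_singleton hv, finrank_span_singleton fun h0 ↦ ?_⟩
    rw [h0, Set.pair_comm, Submodule.span_insert_zero] at h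
    have := finrank_span_singleton_le_one (K := K) v
    omega

/-- Over an algebraically closed field, a nonzero subspace invariant under two projections contains
a nonzero block. -/
lemma exists_isJordanBlock_le [IsAlgClosed K] [FiniteDimensional K E]
    (hP : ∀ x, P (P x) = P x) (hQ : ∀ x, Q (Q x) = Q x) {W : Submodule K E} (hW : W ≠ ⊥)
    (hPW : ∀ x ∈ W, P x ∈ W) (hQW : ∀ x ∈ W, Q x ∈ W) :
    ∃ V ≤ W, V ≠ ⊥ ∧ IsJordanBlock P Q V := by
  by_cases hPW0 : W.map P = ⊥
  · have hP0 : ∀ x ∈ W, P x = 0 := fun x hx ↦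
      (Submodule.mem_bot K).1 (hPW0 ▸ Submodule.mem_map_of_mem hx)
    obtain ⟨w, hwW, hw⟩ := W.exists_mem_ne_zero_of_ne_bot hW
    obtain ⟨v, hvW, hv, b, hQv⟩ : ∃ v ∈ W, v ≠ 0 ∧ ∃ b : K, Q v = b • v := by
      by_cases hQw : Q w = 0
      · exact ⟨w, hwW, hw, 0, by simp [hQw]⟩
      · exact ⟨Q w, hQW w hwW, hQw, 1, by simp [hQ]⟩
    refine ⟨K ∙ v, by simpa using hvW, by simpa using hv,
      isJordanBlock_span_singleton (a := 0) (by simp [hP0 v hvW]) hQv⟩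
  · have hU : ∀ x ∈ W.map P, (P ∘ₗ Q) x ∈ W.map P := by
      rintro _ ⟨x, hx, rfl⟩
      exact Submodule.mem_map_of_mem (hQW _ (hPW x hx))
    have : Nontrivial (W.map P) := Submodule.nontrivial_iff_ne_bot.2 hPW0
    obtain ⟨c, hc⟩ := Module.End.exists_eigenvalue ((P ∘ₗ Q).restrict hU)
    obtain ⟨⟨_, x, hx, rfl⟩, hv⟩ := hc.exists_hasEigenvector
    have hPx : P x ∈ W := hPW x hx
    have hPx0 : P x ≠ 0 := fun h ↦ hv.2 (Subtype.ext h)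
    refine ⟨Submodule.span K {P x, Q (P x)}, ?_, ?_,
      isJordanBlock_span_pair hQ hPx0 (hP x) (congrArg Subtype.val hv.apply_eq_smul)⟩
    · rw [Submodule.span_le, Set.pair_subset_iff]
      exact ⟨hPx, hQW _ hPx⟩
    · exact Submodule.ne_bot_iff _ |>.2 ⟨P x, Submodule.subset_span (by simp), hPx0⟩

end Block

lemma LinearMap.IsSymmetric.apply_mem_orthogonal {𝕜 E : Type*} [RCLike 𝕜] [NormedAddCommGroup E]
    [InnerProductSpace 𝕜 E] {T : E →ₗ[𝕜] E} (hT : T.IsSymmetric) {V : Submodule 𝕜 E}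
    (hV : V.map T ≤ V) {x : E} (hx : x ∈ Vᗮ) : T x ∈ Vᗮ := by
  intro u hu
  rw [← hT]
  exact hx _ (hV (Submodule.mem_map_of_mem hu))

/-- A subspace invariant under two orthogonal projections is an orthogonal sum of blocks. -/
lemma exists_orthogonal_isJordanBlock_iSup_eq {H : Type*} [NormedAddCommGroup H]
    [InnerProductSpace ℂ H] [FiniteDimensional ℂ H] {P Q : H →ₗ[ℂ] H}
    (hPsym : P.IsSymmetric) (hP : ∀ x, P (P x) = P x)
    (hQsym : Q.IsSymmetric) (hQ : ∀ x, Q (Q x) = Q x)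
    (W : Submodule ℂ H) (hPW : ∀ x ∈ W, P x ∈ W) (hQW : ∀ x ∈ W, Q x ∈ W) :
    ∃ (ι : Type) (_ : Fintype ι) (V : ι → Submodule ℂ H),
      Pairwise (fun i j ↦ V i ⟂ V j) ∧ (⨆ i, V i) = W ∧ ∀ i, IsJordanBlock P Q (V i) := by
  induction hn : Module.finrank ℂ W using Nat.strong_induction_on generalizing W with
  | _ n ih =>
  by_cases hW : W = ⊥
  · exact ⟨Empty, inferInstance, Empty.elim, fun i ↦ i.elim, by simp [hW], fun i ↦ i.elim⟩
  obtain ⟨V₀, hV₀W, hV₀, hblock⟩ := exists_isJordanBlock_le hP hQ hW hPW hQW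
  have hsup : V₀ ⊔ V₀ᗮ ⊓ W = W := Submodule.sup_orthogonal_inf_of_hasOrthogonalProjection hV₀W
  have hlt : V₀ᗮ ⊓ W < W := by
    refine lt_of_le_of_ne inf_le_right fun h ↦ hV₀ ?_
    have hle : V₀ ≤ V₀ᗮ := hV₀W.trans (inf_eq_right.1 h)
    exact Submodule.isOrtho_self.1 hle
  obtain ⟨ι, _, V, hV, hVsup, hVblock⟩ := ih _ (hn ▸ Submodule.finrank_lt_finrank_of_lt hlt)
    (V₀ᗮ ⊓ W)
    (fun x hx ↦ ⟨hPsym.apply_mem_orthogonal hblock.map_left_le hx.1, hPW x hx.2⟩)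
    (fun x hx ↦ ⟨hQsym.apply_mem_orthogonal hblock.map_right_le hx.1, hQW x hx.2⟩) rfl
  have hortho : ∀ i, V i ⟂ V₀ := fun i ↦ (le_iSup V i).trans (hVsup.trans_le inf_le_left)
  refine ⟨Option ι, inferInstance, fun i ↦ i.elim V₀ V, ?_, ?_, ?_⟩
  · rintro (_ | i) (_ | j) hij
    · exact (hij rfl).elim
    · exact (hortho j).symm
    · exact hortho i
    · exact hV fun h ↦ hij (congrArg some h)
  · simp only [iSup_option, Option.elim, hVsup, hsup]
  · rintro (_ | i)
    · exact hblock
    · exact hVblock i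

/-- **Jordan's Lemma.** Given two orthogonal projections `P` and `Q` on a
finite-dimensional complex inner product space `H`, the space `H` decomposes as
an orthogonal direct sum of subspaces of dimension at most `2`, each invariant
under both `P` and `Q`, such that on each two-dimensional subspace the
restrictions of `P` and `Q` are rank-one projections. -/
theorem jordan_lemma
    {H : Type*} [NormedAddCommGroup H] [InnerProductSpace ℂ H]
    [FiniteDimensional ℂ H]
    (P Q : H →ₗ[ℂ] H)
    (hPsa : ∀ u v : H, ⟪P u, v⟫ = ⟪u, P v⟫) (hPidem : P ∘ₗ P = P)
    (hQsa : ∀ u v : H, ⟪Q u, v⟫ = ⟪u, Q v⟫) (hQidem : Q ∘ₗ Q = Q) :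
    ∃ (ι : Type) (_ : Fintype ι) (V : ι → Submodule ℂ H),
      (∀ i j, i ≠ j → ∀ u ∈ V i, ∀ v ∈ V j, ⟪u, v⟫ = 0) ∧
      (⨆ i, V i) = ⊤ ∧
      (∀ i, Module.finrank ℂ (V i) ≤ 2) ∧
      (∀ i, Submodule.map P (V i) ≤ V i) ∧
      (∀ i, Submodule.map Q (V i) ≤ V i) ∧
      (∀ i, Module.finrank ℂ (V i) = 2 →
        Module.finrank ℂ (Submodule.map P (V i)) = 1 ∧
        Module.finrank ℂ (Submodule.map Q (V i)) = 1) := by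
  obtain ⟨ι, hι, V, hV, hsup, hblock⟩ := exists_orthogonal_isJordanBlock_iSup_eq
    hPsa (LinearMap.congr_fun hPidem) hQsa (LinearMap.congr_fun hQidem) ⊤
    (fun _ _ ↦ Submodule.mem_top) (fun _ _ ↦ Submodule.mem_top)
  exact ⟨ι, hι, V, fun i j hij u hu v hv ↦ (hV hij).inner_eq hu hv, hsup,
    fun i ↦ (hblock i).finrank_le, fun i ↦ (hblock i).map_left_le,
    fun i ↦ (hblock i).map_right_le, fun i ↦ (hblock i).finrank_map⟩
end

section
/- Let θ ∈ (0, π), let {|v⟩, |v⊥⟩} be an orthonormal basis of ℂ², and let |w⟩ = cos(θ/2)|v⟩ + sin(θ/2)|v⊥⟩. Let Δ = |v⟩⟨v| and Π = |w⟩⟨w| be the rank-one orthogonal projections onto these vectors, and set U = (2Π − I)(2Δ − I). Then U has eigenvector (|v⟩ + i|v⊥⟩)/√2 with eigenvalue e^{−iθ} and eigenvector (|v⟩ − i|v⊥⟩)/√2 with eigenvalue e^{iθ}. -/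
open scoped ComplexInnerProductSpace

section ReflectionProduct

variable {E : Type*} [NormedAddCommGroup E] [InnerProductSpace ℂ E]

/-- In an orthonormal frame `v, vp`, composing the reflection about `v` with the reflection about
`w = cos(θ/2) v + sin(θ/2) vp` rotates the plane of the frame by `θ`. -/
theorem reflection_comp_reflection_eq_rotation (θ : ℝ) {v vp w : E}
    (hv : ‖v‖ = 1) (hvp : ‖vp‖ = 1) (horth : ⟪v, vp⟫ = 0)
    (hw : w = (Real.cos (θ / 2) : ℂ) • v + (Real.sin (θ / 2) : ℂ) • vp)
    {Δ P : E →ₗ[ℂ] E} (hΔ : ∀ x, Δ x = ⟪v, x⟫ • v) (hP : ∀ x, P x = ⟪w, x⟫ • w) (a b : ℂ) :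
    (((2 : ℂ) • P - LinearMap.id) ∘ₗ ((2 : ℂ) • Δ - LinearMap.id)) (a • v + b • vp) =
      (a * Complex.cos θ - b * Complex.sin θ) • v +
        (a * Complex.sin θ + b * Complex.cos θ) • vp := by
  have hvv : ⟪v, v⟫ = 1 := inner_self_eq_one_of_norm_eq_one hv
  have hvpvp : ⟪vp, vp⟫ = 1 := inner_self_eq_one_of_norm_eq_one hvp
  have horth' : ⟪vp, v⟫ = 0 := inner_eq_zero_symm.mp horth
  have hcos : Complex.cos θ = 2 * Complex.cos (θ / 2) ^ 2 - 1 := by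
    rw [← Complex.cos_two_mul, mul_div_cancel₀ _ two_ne_zero]
  have hsin : Complex.sin θ = 2 * Complex.sin (θ / 2) * Complex.cos (θ / 2) := by
    rw [← Complex.sin_two_mul, mul_div_cancel₀ _ two_ne_zero]
  have hsq := Complex.sin_sq_add_cos_sq ((θ : ℂ) / 2)
  have hwv : ⟪w, v⟫ = Complex.cos (θ / 2) := by
    rw [hw, inner_add_left, inner_smul_left, inner_smul_left, hvv, horth', Complex.conj_ofReal]
    simp
  have hwvp : ⟪w, vp⟫ = Complex.sin (θ / 2) := by
    rw [hw, inner_add_left, inner_smul_left, inner_smul_left, hvpvp, horth, Complex.conj_ofReal,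
      Complex.conj_ofReal]
    simp
  have hw' : w = Complex.cos (θ / 2) • v + Complex.sin (θ / 2) • vp := by
    simpa using hw
  have hreflect : ((2 : ℂ) • Δ - LinearMap.id : E →ₗ[ℂ] E) (a • v + b • vp) =
      a • v - b • vp := by
    simp only [LinearMap.sub_apply, LinearMap.smul_apply, LinearMap.id_apply, hΔ, inner_add_right,
      inner_smul_right, hvv, horth]
    module
  rw [LinearMap.comp_apply, hreflect]
  simp only [LinearMap.sub_apply, LinearMap.smul_apply, LinearMap.id_apply, hP, inner_sub_right,
    inner_smul_right, hwv, hwvp]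
  rw [hw', hcos, hsin]
  match_scalars
  · ring
  · linear_combination (-2 * b) * hsq

end ReflectionProduct

/-- The two-dimensional case of the Szegedy/Nagaj–Wocjan–Zhang decomposition:
for an orthonormal pair `v, v⊥` of `ℂ²`, `w = cos(θ/2)v + sin(θ/2)v⊥`, and the
rank-one projections `Δ = |v⟩⟨v|`, `Π = |w⟩⟨w|`, the product of reflections
`U = (2Π − I)(2Δ − I)` has eigenvectors `(v ± i v⊥)/√2` with eigenvalues
`e^{∓iθ}`. -/
theorem two_dim_reflection_eigenvectors
    (θ : ℝ) (hθ₀ : 0 < θ) (hθπ : θ < Real.pi)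
    (v vp : EuclideanSpace ℂ (Fin 2))
    (hv : ‖v‖ = 1) (hvp : ‖vp‖ = 1) (horth : ⟪v, vp⟫ = 0)
    (w : EuclideanSpace ℂ (Fin 2))
    (hw : w = (Real.cos (θ / 2) : ℂ) • v + (Real.sin (θ / 2) : ℂ) • vp)
    (Δ Pi U : EuclideanSpace ℂ (Fin 2) →ₗ[ℂ] EuclideanSpace ℂ (Fin 2))
    (hΔ : ∀ x, Δ x = ⟪v, x⟫ • v)
    (hPi : ∀ x, Pi x = ⟪w, x⟫ • w)
    (hU : U = ((2 : ℂ) • Pi - LinearMap.id) ∘ₗ ((2 : ℂ) • Δ - LinearMap.id)) :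
    U (((Real.sqrt 2 : ℂ))⁻¹ • (v + Complex.I • vp)) =
        Complex.exp (-(θ : ℂ) * Complex.I) •
          (((Real.sqrt 2 : ℂ))⁻¹ • (v + Complex.I • vp)) ∧
    U (((Real.sqrt 2 : ℂ))⁻¹ • (v - Complex.I • vp)) =
        Complex.exp ((θ : ℂ) * Complex.I) •
          (((Real.sqrt 2 : ℂ))⁻¹ • (v - Complex.I • vp)) := by
  have hU' := reflection_comp_reflection_eq_rotation θ hv hvp horth hw hΔ hPi
  rw [← hU] at hU'
  have hexp : Complex.exp (-(θ : ℂ) * Complex.I) =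
      Complex.cos θ - Complex.sin θ * Complex.I := by
    rw [Complex.exp_mul_I, Complex.cos_neg, Complex.sin_neg]
    ring
  have hplus := hU' 1 Complex.I
  have hminus := hU' 1 (-Complex.I)
  rw [one_smul] at hplus hminus
  rw [neg_smul, ← sub_eq_add_neg] at hminus
  rw [map_smul, map_smul, hplus, hminus, hexp, Complex.exp_mul_I]
  constructor
  · match_scalars
    · ring
    · linear_combination
        ((Real.sqrt 2 : ℂ))⁻¹ * Complex.sin θ * Complex.I_sq
  · match_scalars
    · ring
    · linear_combination
        ((Real.sqrt 2 : ℂ))⁻¹ * Complex.sin θ * Complex.I_sq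
end

section
/- (Spectral bounds for PSD matrices.) Let X be a positive semidefinite operator on a finite-dimensional complex inner product space V, let |t⟩ ∈ V, and let X' = X + |t⟩⟨t|. Let {|β⟩} be an orthonormal eigenbasis of X' with corresponding eigenvalues θ(β) ≥ 0. Suppose there is a nonzero vector |ψ⟩ with X|ψ⟩ = 0 and |⟨t|ψ⟩|² ≥ δ‖|ψ⟩‖² for some δ > 0. Then for every γ ≥ 0, Σ_{β : θ(β) ≤ γ, ⟨t|β⟩ ≠ 0} |⟨t|β⟩|² / θ(β) ≤ 4γ/δ. (Each summand is well defined: if ⟨t|β⟩ ≠ 0 then θ(β) = ⟨β|X|β⟩ + |⟨t|β⟩|² > 0.) -/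
open scoped Matrix ComplexOrder Classical

/-- Bessel's inequality for a finite orthonormal family of coordinate vectors. -/
theorem sum_norm_sq_star_dotProduct_le {ι κ : Type*} [Fintype ι] (β : κ → ι → ℂ)
    (horth : ∀ a b, star (β a) ⬝ᵥ β b = if a = b then 1 else 0) (ψ : ι → ℂ) (s : Finset κ) :
    ∑ b ∈ s, ‖star (β b) ⬝ᵥ ψ‖ ^ 2 ≤ ∑ i, ‖ψ i‖ ^ 2 := by
  have hinner : ∀ u v : ι → ℂ, inner ℂ (WithLp.toLp 2 u) (WithLp.toLp 2 v) = star u ⬝ᵥ v := by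
    intro u v
    rw [EuclideanSpace.inner_toLp_toLp, dotProduct_comm]
  have hon : Orthonormal ℂ (fun b => WithLp.toLp 2 (β b)) := by
    rw [orthonormal_iff_ite]
    intro a b
    rw [hinner, horth]
  have h := hon.sum_inner_products_le (WithLp.toLp 2 ψ) (s := s)
  simpa only [hinner, EuclideanSpace.norm_sq_eq] using h

/-- Pairing an eigenvector `b` of `X + |t⟩⟨t|` with a null vector `ψ` of `X`. -/
theorem eigenvalue_mul_star_dotProduct_of_mulVec_eq_zero {ι : Type*} [Fintype ι]
    {X : Matrix ι ι ℂ} (hX : X.IsHermitian) {t b ψ : ι → ℂ} {θ : ℝ}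
    (heig : (X + Matrix.vecMulVec t (star t)) *ᵥ b = (θ : ℂ) • b) (hXψ : X *ᵥ ψ = 0) :
    (θ : ℂ) * (star b ⬝ᵥ ψ) = (star t ⬝ᵥ ψ) * star (star t ⬝ᵥ b) := by
  have h1 : star ((X + Matrix.vecMulVec t (star t)) *ᵥ b) ⬝ᵥ ψ = star ((θ : ℂ) • b) ⬝ᵥ ψ := by
    rw [heig]
  have h2 : star (X *ᵥ b) ⬝ᵥ ψ = 0 := by
    rw [Matrix.star_mulVec, hX.eq, ← Matrix.dotProduct_mulVec, hXψ, dotProduct_zero]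
  rw [Matrix.add_mulVec, star_add, add_dotProduct, h2, Matrix.vecMulVec_mulVec] at h1
  simpa [mul_comm] using h1.symm

/-- **Spectral bounds for PSD matrices.** Let `X` be positive semidefinite,
`X' = X + |t⟩⟨t|`, and let `β` be an orthonormal eigenbasis of `X'` with
nonnegative eigenvalues `θ`. If there is a nonzero `ψ` with `Xψ = 0` and
`|⟨t|ψ⟩|² ≥ δ‖ψ‖²` for some `δ > 0`, then for every `γ ≥ 0`,
`Σ_{β : θ(β) ≤ γ, ⟨t|β⟩ ≠ 0} |⟨t|β⟩|²/θ(β) ≤ 4γ/δ`. -/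
theorem spectral_bound_psd
    {ι : Type*} [Fintype ι] [DecidableEq ι]
    (X : Matrix ι ι ℂ) (hX : X.PosSemidef)
    (t : ι → ℂ)
    (β : ι → ι → ℂ) (θ : ι → ℝ)
    (horth : ∀ a b, star (β a) ⬝ᵥ β b = if a = b then 1 else 0)
    (heig : ∀ b, (X + Matrix.vecMulVec t (star t)) *ᵥ β b = (θ b : ℂ) • β b)
    (hθ : ∀ b, 0 ≤ θ b)
    (ψ : ι → ℂ) (hψ : ψ ≠ 0) (hXψ : X *ᵥ ψ = 0)
    (δ : ℝ) (hδ : 0 < δ)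
    (hover : δ * ∑ i, ‖ψ i‖ ^ 2 ≤ ‖star t ⬝ᵥ ψ‖ ^ 2)
    (γ : ℝ) (hγ : 0 ≤ γ) :
    ∑ b ∈ Finset.univ.filter (fun b => θ b ≤ γ ∧ star t ⬝ᵥ β b ≠ 0),
        ‖star t ⬝ᵥ β b‖ ^ 2 / θ b ≤ 4 * γ / δ := by
  have hψpos : 0 < ∑ i, ‖ψ i‖ ^ 2 := by
    obtain ⟨i, hi⟩ := Function.ne_iff.mp hψ
    exact Finset.sum_pos' (fun _ _ => by positivity)
      ⟨i, Finset.mem_univ i, pow_pos (norm_pos_iff.mpr hi) 2⟩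
  have hc : 0 < ‖star t ⬝ᵥ ψ‖ ^ 2 := (mul_pos hδ hψpos).trans_le hover
  set s := Finset.univ.filter (fun b => θ b ≤ γ ∧ star t ⬝ᵥ β b ≠ 0)
  have hterm : ∀ b ∈ s, ‖star t ⬝ᵥ ψ‖ ^ 2 * (‖star t ⬝ᵥ β b‖ ^ 2 / θ b)
      ≤ γ * ‖star (β b) ⬝ᵥ ψ‖ ^ 2 := by
    intro b hb
    have hbγ : θ b ≤ γ := (Finset.mem_filter.mp hb).2.1
    have h := congrArg norm
      (eigenvalue_mul_star_dotProduct_of_mulVec_eq_zero hX.isHermitian (heig b) hXψ)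
    rw [norm_mul, norm_mul, norm_star, Complex.norm_real, Real.norm_of_nonneg (hθ b)] at h
    calc ‖star t ⬝ᵥ ψ‖ ^ 2 * (‖star t ⬝ᵥ β b‖ ^ 2 / θ b)
        = (θ b * ‖star (β b) ⬝ᵥ ψ‖) ^ 2 / θ b := by rw [h]; ring
      _ = θ b * ‖star (β b) ⬝ᵥ ψ‖ ^ 2 := by
          rcases eq_or_ne (θ b) 0 with h0 | h0
          · simp [h0]
          · field_simp
      _ ≤ γ * ‖star (β b) ⬝ᵥ ψ‖ ^ 2 := by gcongr
  have hsum : ‖star t ⬝ᵥ ψ‖ ^ 2 * ∑ b ∈ s, ‖star t ⬝ᵥ β b‖ ^ 2 / θ b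
      ≤ γ * ∑ i, ‖ψ i‖ ^ 2 := by
    rw [Finset.mul_sum]
    refine (Finset.sum_le_sum hterm).trans ?_
    rw [← Finset.mul_sum]
    refine mul_le_mul_of_nonneg_left (sum_norm_sq_star_dotProduct_le β ?_ ψ s) hγ
    intro a b
    rw [horth]
    congr
  have hbound : ∑ b ∈ s, ‖star t ⬝ᵥ β b‖ ^ 2 / θ b ≤ γ / δ := by
    rw [le_div_iff₀ hδ]
    refine le_of_mul_le_mul_left ?_ hc
    nlinarith [mul_le_mul_of_nonneg_left hsum hδ.le, mul_le_mul_of_nonneg_left hover hγ]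
  refine hbound.trans ?_
  gcongr
  linarith
end

section
/- Let T and U be finite sets, B a complex matrix with rows indexed by T and columns by U, and |t⟩ ∈ ℂ^T. Suppose there exists ψ_T ∈ ℂ^T with B* ψ_T = 0 and ⟨t|ψ_T⟩ ≠ 0. If ζ_{μ₀} ∈ ℂ and ζ_U ∈ ℂ^U satisfy ζ_{μ₀}|t⟩ + B ζ_U = 0, then ζ_{μ₀} = 0. Consequently, every eigenvalue-zero eigenvector of the Hermitian block matrix A' = [[0, |t⟩, B],[⟨t|, 0, 0],[B*, 0, 0]] (indexed by T ⊔ {μ₀} ⊔ U) has zero entry at the coordinate μ₀. -/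
open scoped Matrix

/-- The Hermitian adjacency matrix `A' = [[0, |t⟩, B], [⟨t|, 0, 0], [B*, 0, 0]]`
indexed by `T ⊔ {μ₀} ⊔ U`, obtained from a bipartite graph with biadjacency
matrix `B` by adjoining an extra vertex `μ₀` joined to `T` with weights `t`. -/
def adjExt {T U : Type*} (B : Matrix T U ℂ) (t : T → ℂ) :
    Matrix (T ⊕ Unit ⊕ U) (T ⊕ Unit ⊕ U) ℂ :=
  Matrix.of fun p q =>
    match p, q with
    | Sum.inl i, Sum.inr (Sum.inl _) => t i
    | Sum.inl i, Sum.inr (Sum.inr u) => B i u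
    | Sum.inr (Sum.inl _), Sum.inl i => star (t i)
    | Sum.inr (Sum.inr u), Sum.inl i => star (B i u)
    | _, _ => 0

/-- If `ψ` is orthogonal to the range of `B` but not to `t`, then `t` is linearly independent of
the range of `B`. -/
theorem eq_zero_of_smul_add_mulVec_eq_zero {T U : Type*} [Fintype T] [Fintype U]
    {B : Matrix T U ℂ} {t ψ : T → ℂ} (hB : Bᴴ *ᵥ ψ = 0) (ht : star t ⬝ᵥ ψ ≠ 0)
    {c : ℂ} {v : U → ℂ} (h : c • t + B *ᵥ v = 0) : c = 0 := by
  have hψB : star ψ ᵥ* B = 0 := by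
    simpa [Matrix.star_mulVec] using congrArg star hB
  have htψ : star ψ ⬝ᵥ t ≠ 0 := by
    rw [← star_ne_zero, Matrix.star_dotProduct, star_star]
    exact ht
  have key : c * (star ψ ⬝ᵥ t) = 0 := by
    simpa [dotProduct_add, Matrix.dotProduct_mulVec, hψB] using congrArg (star ψ ⬝ᵥ ·) h
  exact (mul_eq_zero.mp key).resolve_right htψ

/-- If there exists `ψ_T` with `B* ψ_T = 0` and `⟨t|ψ_T⟩ ≠ 0`, then any
`ζ_{μ₀} ∈ ℂ`, `ζ_U` with `ζ_{μ₀}|t⟩ + B ζ_U = 0` must have `ζ_{μ₀} = 0`;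
consequently every eigenvalue-zero eigenvector of the block matrix
`A' = [[0, |t⟩, B], [⟨t|, 0, 0], [B*, 0, 0]]` has zero entry at `μ₀`. -/
theorem zero_eigenvector_vanishes_at_mu0
    {T U : Type*} [Fintype T] [Fintype U] [DecidableEq T] [DecidableEq U]
    (B : Matrix T U ℂ) (t : T → ℂ)
    (ψT : T → ℂ) (hBT : Bᴴ *ᵥ ψT = 0) (htψ : star t ⬝ᵥ ψT ≠ 0) :
    (∀ (ζμ : ℂ) (ζU : U → ℂ), ζμ • t + B *ᵥ ζU = 0 → ζμ = 0) ∧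
    (∀ ζ : (T ⊕ Unit ⊕ U) → ℂ, adjExt B t *ᵥ ζ = 0 →
      ζ (Sum.inr (Sum.inl ())) = 0) := by
  refine ⟨fun _ _ h => eq_zero_of_smul_add_mulVec_eq_zero hBT htψ h, fun ζ hζ => ?_⟩
  refine eq_zero_of_smul_add_mulVec_eq_zero (v := fun u => ζ (Sum.inr (Sum.inr u))) hBT htψ ?_
  ext i
  simpa [adjExt, Matrix.mulVec, dotProduct, mul_comm] using congrFun hζ (Sum.inl i)
end

section
/- Let Δ and Π be orthogonal projections on a finite-dimensional complex inner product space, and let U = (2Π − I)(2Δ − I). Write the eigenvalues of the unitary U as e^{iθ}, θ ∈ (−π, π]. Let 0 ≤ Θ < π and let ζ be a unit vector lying in the span of the eigenvectors of U whose phases θ satisfy 0 < |θ| ≤ Θ. Then ‖Π(I − Δ)ζ‖ ≤ Θ/2. -/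
open scoped ComplexInnerProductSpace

/-- On the span of eigenvectors with eigenvalues at most `c`, the quadratic form of a symmetric
operator is bounded by `c`. -/
theorem LinearMap.IsSymmetric.re_inner_le_of_mem_span
    {H : Type*} [NormedAddCommGroup H] [InnerProductSpace ℂ H] [FiniteDimensional ℂ H]
    {T : H →ₗ[ℂ] H} (hT : T.IsSymmetric) {c : ℝ} {x : H}
    (hx : x ∈ Submodule.span ℂ {v : H | ∃ ν : ℝ, ν ≤ c ∧ T v = (ν : ℂ) • v}) :
    (⟪x, T x⟫).re ≤ c * ‖x‖ ^ 2 := by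
  set b := hT.eigenvectorBasis rfl
  set μ := hT.eigenvalues rfl
  have hb (i) : T (b i) = (μ i : ℂ) • b i := hT.apply_eigenvectorBasis rfl i
  have hzero (i) (hi : c < μ i) : ⟪b i, x⟫ = 0 := by
    induction hx using Submodule.span_induction with
    | mem v hv =>
      obtain ⟨ν, hν, hv⟩ := hv
      have h := hT (b i) v
      rw [hb, hv, inner_smul_left, inner_smul_right, Complex.conj_ofReal] at h
      have hne : (μ i : ℂ) - ν ≠ 0 := by
        rw [sub_ne_zero]
        exact_mod_cast (hν.trans_lt hi).ne'
      exact (mul_eq_zero.mp (by linear_combination h : ((μ i : ℂ) - ν) * ⟪b i, v⟫ = 0)).resolve_left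
        hne
    | zero => simp
    | add u v _ _ hu hv => rw [inner_add_right, hu, hv, add_zero]
    | smul a v _ hv => rw [inner_smul_right, hv, mul_zero]
  have hterm (i) : ⟪x, b i⟫ * ⟪b i, T x⟫ = ((μ i * ‖⟪b i, x⟫‖ ^ 2 : ℝ) : ℂ) := by
    rw [← hT, hb, inner_smul_left, Complex.conj_ofReal, ← inner_conj_symm x (b i)]
    push_cast
    rw [← Complex.conj_mul']
    ring
  rw [← b.sum_inner_mul_inner x (T x), ← b.sum_sq_norm_inner_right x, Complex.re_sum,
    Finset.mul_sum]
  refine Finset.sum_le_sum fun i _ ↦ ?_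
  rw [hterm, Complex.ofReal_re]
  by_cases hi : c < μ i
  · simp [hzero i hi]
  · exact mul_le_mul_of_nonneg_right (not_lt.mp hi) (by positivity)

/-- The square of the difference of two idempotents commutes with each of them. -/
theorem IsIdempotentElem.commute_sub_sq {R : Type*} [Ring R] {p q : R}
    (hp : IsIdempotentElem p) (hq : IsIdempotentElem q) : Commute ((p - q) ^ 2) q := by
  have h : (p - q) ^ 2 = p - p * q - q * p + q := by
    rw [sq, sub_mul, mul_sub, mul_sub, hp.eq, hq.eq]
    abel
  rw [Commute, SemiconjBy, h]
  simp only [add_mul, sub_mul, mul_add, mul_sub, mul_assoc, hq.eq]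
  simp only [← mul_assoc, hq.eq]
  abel

/-- An eigenvector of a product of two reflections with phase `θ` is an eigenvector of the square
of the difference of the corresponding projections. -/
theorem sub_sq_apply_of_reflection_mul_apply {H : Type*} [AddCommGroup H] [Module ℂ H]
    {P Q : Module.End ℂ H} (hP : IsIdempotentElem P) (hQ : IsIdempotentElem Q) {v : H} {θ : ℝ}
    (hv : (((2 : ℂ) • P - 1) * ((2 : ℂ) • Q - 1)) v = Complex.exp (θ * Complex.I) • v) :
    ((P - Q) ^ 2) v = (((1 - Real.cos θ) / 2 : ℝ) : ℂ) • v := by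
  have hPP (x : H) : P (P x) = P x := LinearMap.congr_fun hP.eq x
  have hQQ (x : H) : Q (Q x) = Q x := LinearMap.congr_fun hQ.eq x
  have hinv : (((2 : ℂ) • Q - 1) * ((2 : ℂ) • P - 1)) v = Complex.exp (-θ * Complex.I) • v := by
    have h : (((2 : ℂ) • Q - 1) * ((2 : ℂ) • P - 1))
        ((((2 : ℂ) • P - 1) * ((2 : ℂ) • Q - 1)) v) = v := by
      simp [hPP, hQQ]
      module
    rw [hv, map_smul] at h
    conv_rhs => rw [← h]
    rw [smul_smul, ← Complex.exp_add]
    simp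
  have hsum : (4 : ℂ) • ((P - Q) ^ 2) v = (2 : ℂ) • v
      - (((2 : ℂ) • P - 1) * ((2 : ℂ) • Q - 1)) v
      - (((2 : ℂ) • Q - 1) * ((2 : ℂ) • P - 1)) v := by
    simp [sq, hPP, hQQ]
    module
  rw [hv, hinv] at hsum
  have hcos : (((1 - Real.cos θ) / 2 : ℝ) : ℂ) =
      (1 / 4) * (2 - Complex.exp (θ * Complex.I) - Complex.exp (-θ * Complex.I)) := by
    push_cast
    rw [Complex.cos]
    ring
  rw [hcos, mul_smul, sub_smul, sub_smul, ← hsum, smul_smul]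
  norm_num

/-- Let `Δ` and `Pi` be orthogonal projections on a finite-dimensional complex
inner product space, and `U = (2Pi − I)(2Δ − I)`. If `ζ` is a unit vector lying
in the span of eigenvectors of `U` whose eigenvalue phases `θ ∈ (−π, π]` satisfy
`0 < |θ| ≤ Θ` for some `0 ≤ Θ < π`, then `‖Pi (I − Δ) ζ‖ ≤ Θ/2`. -/
theorem low_phase_projection_bound
    {H : Type*} [NormedAddCommGroup H] [InnerProductSpace ℂ H]
    [FiniteDimensional ℂ H]
    (Δ Pi : H →ₗ[ℂ] H)
    (hΔsa : ∀ u v : H, ⟪Δ u, v⟫ = ⟪u, Δ v⟫) (hΔidem : Δ ∘ₗ Δ = Δ)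
    (hPisa : ∀ u v : H, ⟪Pi u, v⟫ = ⟪u, Pi v⟫) (hPiidem : Pi ∘ₗ Pi = Pi)
    (U : H →ₗ[ℂ] H)
    (hU : U = ((2 : ℂ) • Pi - LinearMap.id) ∘ₗ ((2 : ℂ) • Δ - LinearMap.id))
    (Θ : ℝ) (hΘ₀ : 0 ≤ Θ) (hΘπ : Θ < Real.pi)
    {ι : Type*} [Fintype ι] (vecs : ι → H) (θs : ι → ℝ)
    (hphase : ∀ i, θs i ∈ Set.Ioc (-Real.pi) Real.pi)
    (heig : ∀ i, U (vecs i) = Complex.exp ((θs i : ℂ) * Complex.I) • vecs i)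
    (hrange : ∀ i, 0 < |θs i| ∧ |θs i| ≤ Θ)
    (ζ : H) (hζnorm : ‖ζ‖ = 1)
    (hζspan : ζ ∈ Submodule.span ℂ (Set.range vecs)) :
    ‖Pi (ζ - Δ ζ)‖ ≤ Θ / 2 := by
  have hΔ : IsIdempotentElem (Δ : Module.End ℂ H) := hΔidem
  have hPi : IsIdempotentElem (Pi : Module.End ℂ H) := hPiidem
  have hsub (u v : H) : ⟪(Pi - Δ) u, v⟫ = ⟪u, (Pi - Δ) v⟫ := by
    rw [LinearMap.sub_apply, LinearMap.sub_apply, inner_sub_left, inner_sub_right, hΔsa, hPisa]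
  set T : Module.End ℂ H := (Pi - Δ) ^ 2 with hT
  have hTapply (v : H) : T v = (Pi - Δ) ((Pi - Δ) v) := by rw [hT, sq]; rfl
  have hTsymm : LinearMap.IsSymmetric T := fun u v ↦ by rw [hTapply, hTapply, hsub, hsub]
  have hcomm (v : H) : T (Δ v) = Δ (T v) := LinearMap.congr_fun (hPi.commute_sub_sq hΔ).eq v
  have hmem : ζ - Δ ζ ∈
      Submodule.span ℂ {v : H | ∃ ν : ℝ, ν ≤ (Θ / 2) ^ 2 ∧ T v = (ν : ℂ) • v} := by
    suffices h : Submodule.span ℂ (Set.range vecs) ≤ Submodule.comap (LinearMap.id - Δ)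
        (Submodule.span ℂ {v : H | ∃ ν : ℝ, ν ≤ (Θ / 2) ^ 2 ∧ T v = (ν : ℂ) • v}) from h hζspan
    rw [Submodule.span_le]
    rintro _ ⟨i, rfl⟩
    refine Submodule.subset_span ⟨(1 - Real.cos (θs i)) / 2, ?_, ?_⟩
    · have hcos := Real.one_sub_sq_div_two_le_cos (x := θs i)
      have hsq : θs i ^ 2 ≤ Θ ^ 2 := sq_le_sq' (abs_le.mp (hrange i).2).1 (abs_le.mp (hrange i).2).2
      linarith
    · have h := sub_sq_apply_of_reflection_mul_apply hPi hΔ (hU ▸ heig i)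
      change T (vecs i - Δ (vecs i)) = _ • (vecs i - Δ (vecs i))
      rw [map_sub, hcomm, h, map_smul, smul_sub]
  have hΔη : Δ (ζ - Δ ζ) = 0 := by
    rw [map_sub, ← LinearMap.comp_apply, hΔidem, sub_self]
  have hηnorm : ‖ζ - Δ ζ‖ ≤ 1 := by
    have horth : ⟪Δ ζ, ζ - Δ ζ⟫ = 0 := by rw [hΔsa, hΔη, inner_zero_right]
    have h := norm_add_sq_eq_norm_sq_add_norm_sq_of_inner_eq_zero _ _ horth
    rw [add_sub_cancel, hζnorm] at h
    nlinarith [norm_nonneg (ζ - Δ ζ), norm_nonneg (Δ ζ)]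
  have hnorm : ‖Pi (ζ - Δ ζ)‖ ^ 2 = (⟪ζ - Δ ζ, T (ζ - Δ ζ)⟫).re := by
    rw [hTapply, ← hsub, LinearMap.sub_apply, hΔη, sub_zero]
    exact (inner_self_eq_norm_sq (𝕜 := ℂ) _).symm
  have hle := hTsymm.re_inner_le_of_mem_span hmem
  rw [← hnorm] at hle
  refine (sq_le_sq₀ (norm_nonneg _) (by positivity)).mp ?_
  exact hle.trans (mul_le_of_le_one_right (by positivity) (pow_le_one₀ (norm_nonneg _) hηnorm))
end

section
/- Let Δ and Π be orthogonal projections on a finite-dimensional complex inner product space, and let U = (2Π − I)(2Δ − I). Write the eigenvalues of the unitary U as e^{iθ}, θ ∈ (−π, π]. Let 0 ≤ Θ < π and let ζ be a unit vector lying in the span of the eigenvectors of U whose phases θ satisfy 0 < |θ| ≤ Θ. Then ‖(I − Π)Δζ‖ ≤ (Θ/2)·‖Δζ‖. -/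
open scoped ComplexInnerProductSpace

/-- Eigenspaces of a norm-preserving linear map are pairwise orthogonal. -/
theorem orthogonalFamily_eigenspaces_of_inner_map_map
    {H : Type*} [NormedAddCommGroup H] [InnerProductSpace ℂ H] (U : H →ₗ[ℂ] H)
    (hU : ∀ u v : H, ⟪U u, U v⟫ = ⟪u, v⟫) :
    OrthogonalFamily ℂ (fun μ : ℂ => Module.End.eigenspace U μ)
      fun μ => (Module.End.eigenspace U μ).subtypeₗᵢ := by
  rintro μ ν hμν ⟨v, hv⟩ ⟨w, hw⟩
  rw [Module.End.mem_eigenspace_iff] at hv hw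
  change ⟪v, w⟫ = 0
  by_contra hne
  have hv0 : ⟪v, v⟫ ≠ 0 := by
    rw [Ne, inner_self_eq_zero]
    rintro rfl
    simp at hne
  have h1 := hU v v
  have h2 := hU v w
  rw [hv, inner_smul_left, inner_smul_right, ← mul_assoc] at h1
  rw [hv, hw, inner_smul_left, inner_smul_right, ← mul_assoc] at h2
  have h1' : (starRingEnd ℂ) μ * μ = 1 := mul_right_cancel₀ hv0 (by rw [h1, one_mul])
  have h2' : (starRingEnd ℂ) μ * ν = 1 := mul_right_cancel₀ hne (by rw [h2, one_mul])
  exact hμν (mul_left_cancel₀ (left_ne_zero_of_mul_eq_one h1') (h1'.trans h2'.symm))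

/-- A norm-preserving linear map moves a vector in the span of its eigenspaces with eigenvalues
within `r` of `1` by at most `r` times the norm of the vector. -/
theorem norm_map_sub_self_le_of_mem_iSup_eigenspace
    {H : Type*} [NormedAddCommGroup H] [InnerProductSpace ℂ H] (U : H →ₗ[ℂ] H)
    (hU : ∀ u v : H, ⟪U u, U v⟫ = ⟪u, v⟫) {r : ℝ} (hr : 0 ≤ r) {w : H}
    (hw : w ∈ ⨆ μ : {μ : ℂ // ‖μ - 1‖ ≤ r}, Module.End.eigenspace U (μ : ℂ)) :
    ‖U w - w‖ ≤ r * ‖w‖ := by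
  classical
  have hV := (orthogonalFamily_eigenspaces_of_inner_map_map U hU).comp
    (Subtype.val_injective (p := fun μ : ℂ => ‖μ - 1‖ ≤ r))
  obtain ⟨f, rfl⟩ := (Submodule.mem_iSup_iff_exists_dfinsupp' _ _).1 hw
  have hsum : (f.sum fun _ x => (x : H)) = ∑ i ∈ f.support, (f i : H) := rfl
  rw [hsum]
  have hmove : U (∑ i ∈ f.support, (f i : H)) - ∑ i ∈ f.support, (f i : H) =
      ∑ i ∈ f.support, (((i : ℂ) - 1) • f i : Module.End.eigenspace U (i : ℂ)).1 := by
    rw [map_sum, ← Finset.sum_sub_distrib]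
    refine Finset.sum_congr rfl fun i _ => ?_
    rw [Module.End.mem_eigenspace_iff.1 (f i).2]
    simp [sub_smul]
  have h1 : ‖∑ i ∈ f.support, (((i : ℂ) - 1) • f i : Module.End.eigenspace U (i : ℂ)).1‖ ^ 2 =
      ∑ i ∈ f.support, ‖((i : ℂ) - 1) • f i‖ ^ 2 :=
    hV.norm_sum (fun i => ((i : ℂ) - 1) • f i) f.support
  have h2 : ‖∑ i ∈ f.support, (f i : H)‖ ^ 2 = ∑ i ∈ f.support, ‖f i‖ ^ 2 :=
    hV.norm_sum f f.support
  rw [hmove]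
  refine (sq_le_sq₀ (norm_nonneg _) (by positivity)).1 ?_
  rw [h1, mul_pow, h2, Finset.mul_sum]
  refine Finset.sum_le_sum fun i _ => ?_
  rw [norm_smul, mul_pow]
  have := i.2
  gcongr

/-- The reflection `2P - I` through the range of an orthogonal projection is an involution. -/
theorem two_smul_sub_id_apply_apply {H : Type*} [AddCommGroup H] [Module ℂ H]
    {P : H →ₗ[ℂ] H} (hP : P ∘ₗ P = P) (x : H) :
    ((2 : ℂ) • P - LinearMap.id : H →ₗ[ℂ] H) (((2 : ℂ) • P - LinearMap.id : H →ₗ[ℂ] H) x) = x := by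
  have h : P (P x) = P x := LinearMap.congr_fun hP x
  simp only [LinearMap.sub_apply, LinearMap.smul_apply, LinearMap.id_apply, map_sub, map_smul, h]
  module

/-- The reflection `2P - I` through the range of an orthogonal projection preserves inner
products. -/
theorem inner_two_smul_sub_id_apply {H : Type*} [NormedAddCommGroup H] [InnerProductSpace ℂ H]
    {P : H →ₗ[ℂ] H} (hsa : ∀ u v : H, ⟪P u, v⟫ = ⟪u, P v⟫) (hP : P ∘ₗ P = P) (u v : H) :
    ⟪((2 : ℂ) • P - LinearMap.id : H →ₗ[ℂ] H) u,
      ((2 : ℂ) • P - LinearMap.id : H →ₗ[ℂ] H) v⟫ = ⟪u, v⟫ := by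
  have h : P (P v) = P v := LinearMap.congr_fun hP v
  simp only [LinearMap.sub_apply, LinearMap.smul_apply, LinearMap.id_apply, inner_sub_left,
    inner_sub_right, inner_smul_left, inner_smul_right, hsa, h, map_ofNat]
  ring

/-- Let `Δ` and `Pi` be orthogonal projections on a finite-dimensional complex
inner product space, and `U = (2Pi − I)(2Δ − I)`. If `ζ` is a unit vector lying
in the span of eigenvectors of `U` whose eigenvalue phases `θ ∈ (−π, π]` satisfy
`0 < |θ| ≤ Θ` for some `0 ≤ Θ < π`, then `‖(I − Pi) Δ ζ‖ ≤ (Θ/2)‖Δ ζ‖`. -/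
theorem low_phase_complement_projection_bound
    {H : Type*} [NormedAddCommGroup H] [InnerProductSpace ℂ H]
    [FiniteDimensional ℂ H]
    (Δ Pi : H →ₗ[ℂ] H)
    (hΔsa : ∀ u v : H, ⟪Δ u, v⟫ = ⟪u, Δ v⟫) (hΔidem : Δ ∘ₗ Δ = Δ)
    (hPisa : ∀ u v : H, ⟪Pi u, v⟫ = ⟪u, Pi v⟫) (hPiidem : Pi ∘ₗ Pi = Pi)
    (U : H →ₗ[ℂ] H)
    (hU : U = ((2 : ℂ) • Pi - LinearMap.id) ∘ₗ ((2 : ℂ) • Δ - LinearMap.id))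
    (Θ : ℝ) (hΘ₀ : 0 ≤ Θ) (hΘπ : Θ < Real.pi)
    {ι : Type*} [Fintype ι] (vecs : ι → H) (θs : ι → ℝ)
    (hphase : ∀ i, θs i ∈ Set.Ioc (-Real.pi) Real.pi)
    (heig : ∀ i, U (vecs i) = Complex.exp ((θs i : ℂ) * Complex.I) • vecs i)
    (hrange : ∀ i, 0 < |θs i| ∧ |θs i| ≤ Θ)
    (ζ : H) (hζnorm : ‖ζ‖ = 1)
    (hζspan : ζ ∈ Submodule.span ℂ (Set.range vecs)) :
    ‖Δ ζ - Pi (Δ ζ)‖ ≤ (Θ / 2) * ‖Δ ζ‖ := by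
  have hUinner : ∀ u v : H, ⟪U u, U v⟫ = ⟪u, v⟫ := fun u v => by
    rw [hU, LinearMap.comp_apply, LinearMap.comp_apply,
      inner_two_smul_sub_id_apply hPisa hPiidem, inner_two_smul_sub_id_apply hΔsa hΔidem]
  have hexp : ∀ t : ℝ, |t| ≤ Θ → ‖Complex.exp ((t : ℂ) * Complex.I) - 1‖ ≤ Θ := fun t ht => by
    rw [mul_comm]
    exact (Real.norm_exp_I_mul_ofReal_sub_one_le).trans ht
  have hmem : Δ ζ ∈ ⨆ μ : {μ : ℂ // ‖μ - 1‖ ≤ Θ}, Module.End.eigenspace U (μ : ℂ) := by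
    rw [← Submodule.mem_comap]
    refine Submodule.span_le.2 ?_ hζspan
    rintro _ ⟨i, rfl⟩
    have hsplit : Δ (vecs i) =
        (1 / 2 : ℂ) • (vecs i + ((2 : ℂ) • Δ - LinearMap.id : H →ₗ[ℂ] H) (vecs i)) := by
      simp only [LinearMap.sub_apply, LinearMap.smul_apply, LinearMap.id_apply]
      module
    have hneg : U (((2 : ℂ) • Δ - LinearMap.id : H →ₗ[ℂ] H) (vecs i)) =
        Complex.exp (((-θs i : ℝ) : ℂ) * Complex.I) •
          ((2 : ℂ) • Δ - LinearMap.id : H →ₗ[ℂ] H) (vecs i) := by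
      have h := congrArg ((2 : ℂ) • Pi - LinearMap.id : H →ₗ[ℂ] H) (heig i)
      rw [hU, LinearMap.comp_apply, two_smul_sub_id_apply_apply hPiidem, map_smul] at h
      rw [h, smul_smul, ← Complex.exp_add, hU, LinearMap.comp_apply, ← h,
        two_smul_sub_id_apply_apply hΔidem]
      simp
    rw [SetLike.mem_coe, Submodule.mem_comap, hsplit]
    refine Submodule.smul_mem _ _ (Submodule.add_mem _ ?_ ?_)
    · exact Submodule.mem_iSup_of_mem ⟨_, hexp (θs i) (hrange i).2⟩
        (Module.End.mem_eigenspace_iff.2 (heig i))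
    · exact Submodule.mem_iSup_of_mem ⟨_, hexp (-θs i) (by rw [abs_neg]; exact (hrange i).2)⟩
        (Module.End.mem_eigenspace_iff.2 hneg)
  have hbound := norm_map_sub_self_le_of_mem_iSup_eigenspace U hUinner hΘ₀ hmem
  have hΔΔ : Δ (Δ ζ) = Δ ζ := LinearMap.congr_fun hΔidem ζ
  have hUΔ : U (Δ ζ) - Δ ζ = (-2 : ℂ) • (Δ ζ - Pi (Δ ζ)) := by
    simp only [hU, LinearMap.comp_apply, LinearMap.sub_apply, LinearMap.smul_apply,
      LinearMap.id_apply, hΔΔ, map_sub, map_smul]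
    module
  rw [hUΔ, norm_smul, norm_neg, Complex.norm_ofNat] at hbound
  linarith
end

section
/- Let U be a unitary operator on ℂ^d with orthonormal eigenbasis {|β⟩} and eigenvalues e^{iθ(β)}, θ(β) ∈ (−π, π]. Let u ∈ ℂ^d be a unit vector, let Θ ∈ (0, π], let τ be a positive integer, and set ν = Σ_{β : |θ(β)| ≤ Θ} |⟨β|u⟩|². Then (1/τ) Σ_{T=1}^{τ} (1/4)‖(I + U^T)u‖² ≤ ν + (1 − ν)·(1/2 + 1/(4τ sin(Θ/2))). -/
open scoped ComplexInnerProductSpace Classical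

/-- The sum `Σ_{T=1}^{n} cos (T t)` in closed form, multiplied by `2 sin (t / 2)`. -/
lemma two_mul_sin_half_mul_sum_cos (t : ℝ) (n : ℕ) :
    2 * Real.sin (t / 2) * ∑ T ∈ Finset.Icc 1 n, Real.cos (T * t) =
      Real.sin (n * t + t / 2) - Real.sin (t / 2) := by
  induction n with
  | zero => simp
  | succ n ih =>
    rw [Finset.sum_Icc_succ_top (by omega), mul_add, ih]
    have h1 : (n : ℝ) * t + t / 2 = (n + 1) * t - t / 2 := by ring
    push_cast
    rw [h1, Real.sin_sub, Real.sin_add]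
    ring

lemma sum_cos_le {t s : ℝ} (hs : 0 < s) (hst : s ≤ Real.sin (|t| / 2)) (n : ℕ) :
    ∑ T ∈ Finset.Icc 1 n, Real.cos (T * t) ≤ 1 / (2 * s) := by
  have habs : ∑ T ∈ Finset.Icc 1 n, Real.cos (T * t) =
      ∑ T ∈ Finset.Icc 1 n, Real.cos (T * |t|) := by
    refine Finset.sum_congr rfl fun T _ => ?_
    rw [← Real.cos_abs, abs_mul, Nat.abs_cast]
  have h := two_mul_sin_half_mul_sum_cos |t| n
  rw [← habs] at h
  have h1 := Real.sin_le_one (n * |t| + |t| / 2)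
  rw [le_div_iff₀ (by positivity)]
  by_contra! hc
  have hpos : 0 < ∑ T ∈ Finset.Icc 1 n, Real.cos (T * t) :=
    pos_of_mul_pos_left (lt_trans one_pos hc) (by positivity)
  nlinarith [mul_le_mul_of_nonneg_right hst hpos.le]

lemma norm_one_add_exp_pow_sq (t : ℝ) (T : ℕ) :
    ‖1 + Complex.exp ((t : ℂ) * Complex.I) ^ T‖ ^ 2 = 2 + 2 * Real.cos (T * t) := by
  have h : (T : ℂ) * ((t : ℂ) * Complex.I) = ((T * t : ℝ) : ℂ) * Complex.I := by
    push_cast; ring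
  rw [← Complex.exp_nat_mul, h, ← Complex.normSq_eq_norm_sq, Complex.normSq_apply]
  simp only [Complex.add_re, Complex.add_im, Complex.one_re, Complex.one_im,
    Complex.exp_ofReal_mul_I_re, Complex.exp_ofReal_mul_I_im]
  nlinarith [Real.sin_sq_add_cos_sq (T * t)]

/-- The coordinates of `(1 + U ^ T) u` in an orthonormal eigenbasis of `U`. -/
lemma OrthonormalBasis.inner_one_add_pow_apply {ι E : Type*} [Fintype ι]
    [NormedAddCommGroup E] [InnerProductSpace ℂ E] (B : OrthonormalBasis ι ℂ E)
    (U : E →L[ℂ] E) (c : ι → ℂ) (hc : ∀ b, U (B b) = c b • B b) (u : E) (T : ℕ) (b : ι) :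
    inner ℂ (B b) ((1 + U ^ T) u) = (1 + c b ^ T) * inner ℂ (B b) u := by
  have hpow : ∀ b, (U ^ T) (B b) = c b ^ T • B b := by
    intro b
    induction T with
    | zero => simp
    | succ n ih => rw [pow_succ, mul_apply_eq_comp, hc, map_smul, ih, smul_smul,
        pow_succ, mul_comm]
  have hexp : (U ^ T) u = ∑ a, (inner ℂ (B a) u * c a ^ T) • B a := by
    conv_lhs => rw [← B.sum_repr' u]
    simp [map_sum, hpow, smul_smul]
  rw [add_apply, inner_add_right, hexp, B.orthonormal.inner_right_fintype]
  simp only [one_apply_eq_self]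
  ring

/-- Soundness of the quantum-search span program evaluation algorithm: if `U` is
a unitary on `ℂ^d` with orthonormal eigenbasis `β` and eigenvalue phases
`θ(β) ∈ (−π, π]`, `u` is a unit vector, and `ν` is the squared mass of `u` on
the eigenvectors with `|θ(β)| ≤ Θ`, then
`(1/τ) Σ_{T=1}^{τ} ¼‖(I + U^T)u‖² ≤ ν + (1 − ν)(1/2 + 1/(4τ sin(Θ/2)))`. -/
theorem quantum_search_soundness
    (d : ℕ)
    (U : EuclideanSpace ℂ (Fin d) →L[ℂ] EuclideanSpace ℂ (Fin d))
    (hUiso : ∀ x, ‖U x‖ = ‖x‖)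
    (β : Fin d → EuclideanSpace ℂ (Fin d)) (θ : Fin d → ℝ)
    (horth : Orthonormal ℂ β)
    (hphase : ∀ b, θ b ∈ Set.Ioc (-Real.pi) Real.pi)
    (heig : ∀ b, U (β b) = Complex.exp ((θ b : ℂ) * Complex.I) • β b)
    (u : EuclideanSpace ℂ (Fin d)) (hu : ‖u‖ = 1)
    (Θ : ℝ) (hΘ : Θ ∈ Set.Ioc (0 : ℝ) Real.pi)
    (τ : ℕ) (hτ : 0 < τ)
    (ν : ℝ)
    (hν : ν = ∑ b ∈ Finset.univ.filter (fun b => |θ b| ≤ Θ), ‖⟪β b, u⟫‖ ^ 2) :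
    (1 / (τ : ℝ)) * ∑ T ∈ Finset.Icc 1 τ, (1 / 4) * ‖(1 + U ^ T) u‖ ^ 2 ≤
      ν + (1 - ν) * (1 / 2 + 1 / (4 * τ * Real.sin (Θ / 2))) := by
  obtain ⟨hΘ0, hΘπ⟩ := hΘ
  have hτ' : (0 : ℝ) < τ := by exact_mod_cast hτ
  have hs : 0 < Real.sin (Θ / 2) :=
    Real.sin_pos_of_pos_of_lt_pi (by linarith) (by linarith [Real.pi_pos])
  have hspan : ⊤ ≤ Submodule.span ℂ (Set.range β) :=
    (horth.linearIndependent.span_eq_top_of_card_eq_finrank' (by simp)).ge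
  set B := OrthonormalBasis.mk horth hspan with hB
  have hBβ : ∀ b, B b = β b := fun b => by simp [hB]
  have hmass : ∑ b, ‖⟪β b, u⟫‖ ^ 2 = 1 := by
    simpa [hBβ, hu] using B.sum_sq_norm_inner_right u
  have hnorm : ∀ T : ℕ, (1 / 4) * ‖(1 + U ^ T) u‖ ^ 2 =
      ∑ b, ‖⟪β b, u⟫‖ ^ 2 * (1 / 2 + Real.cos (T * θ b) / 2) := by
    intro T
    rw [← B.sum_sq_norm_inner_right, Finset.mul_sum]
    refine Finset.sum_congr rfl fun b _ => ?_
    rw [B.inner_one_add_pow_apply U _ (fun b => by rw [hBβ]; exact heig b), norm_mul, mul_pow,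
      norm_one_add_exp_pow_sq, hBβ]
    ring
  set K : ℝ := 1 / 2 + 1 / (4 * τ * Real.sin (Θ / 2)) with hK
  have hlhs : (1 / (τ : ℝ)) * ∑ T ∈ Finset.Icc 1 τ, (1 / 4) * ‖(1 + U ^ T) u‖ ^ 2 =
      ∑ b, ‖⟪β b, u⟫‖ ^ 2 *
        (1 / 2 + 1 / (2 * τ) * ∑ T ∈ Finset.Icc 1 τ, Real.cos (T * θ b)) := by
    simp_rw [hnorm]
    rw [Finset.sum_comm, Finset.mul_sum]
    refine Finset.sum_congr rfl fun b _ => ?_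
    rw [← Finset.mul_sum, Finset.sum_add_distrib, Finset.sum_const, Nat.card_Icc,
      add_tsub_cancel_right, nsmul_eq_mul, ← Finset.sum_div]
    field_simp
    simp only [mul_comm (θ b)]
  have hbound : ∀ b, ‖⟪β b, u⟫‖ ^ 2 *
        (1 / 2 + 1 / (2 * τ) * ∑ T ∈ Finset.Icc 1 τ, Real.cos (T * θ b)) ≤
      ‖⟪β b, u⟫‖ ^ 2 * (if |θ b| ≤ Θ then 1 else K) := by
    intro b
    refine mul_le_mul_of_nonneg_left ?_ (by positivity)
    split_ifs with hb
    · have hcos : ∑ T ∈ Finset.Icc 1 τ, Real.cos (T * θ b) ≤ τ := by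
        simpa using Finset.sum_le_card_nsmul (Finset.Icc 1 τ) (fun T : ℕ => Real.cos (T * θ b)) 1
          fun T _ => Real.cos_le_one _
      calc _ ≤ 1 / 2 + 1 / (2 * (τ : ℝ)) * τ := by gcongr
        _ = 1 := by field_simp; norm_num
    · have hπ : |θ b| ≤ Real.pi := abs_le.2 ⟨(hphase b).1.le, (hphase b).2⟩
      have hsin : Real.sin (Θ / 2) ≤ Real.sin (|θ b| / 2) :=
        Real.sin_le_sin_of_le_of_le_pi_div_two (by linarith [Real.pi_pos]) (by linarith)
          (by linarith)
      calc _ ≤ 1 / 2 + 1 / (2 * (τ : ℝ)) * (1 / (2 * Real.sin (Θ / 2))) := by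
            gcongr
            exact sum_cos_le hs hsin τ
        _ = K := by rw [hK]; field_simp; ring
  have hsplit : ∑ b, ‖⟪β b, u⟫‖ ^ 2 * (if |θ b| ≤ Θ then 1 else K) = ν + (1 - ν) * K := by
    have hcompl : 1 - ν = ∑ b with ¬ |θ b| ≤ Θ, ‖⟪β b, u⟫‖ ^ 2 := by
      rw [hν, sub_eq_iff_eq_add', Finset.sum_filter_add_sum_filter_not, hmass]
    rw [hcompl, hν, Finset.sum_mul]
    simp only [mul_ite, mul_one, Finset.sum_ite]
  rw [hlhs, ← hsplit]
  exact Finset.sum_le_sum fun b _ => hbound b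
end

section
/- Let f : {0,1}^n → {0,1}, F₀ = f⁻¹(0), F₁ = f⁻¹(1), let m be a positive integer and W ≥ 1 a real number. Suppose vectors v_{s,j} ∈ ℂ^m are given for all s ∈ {0,1}^n, j ∈ [n], satisfying (i) Σ_{j : w_j ≠ x_j} ⟨v_{w,j}|v_{x,j}⟩ = 1 for all w ∈ F₀, x ∈ F₁, and (ii) Σ_{j ∈ [n]} ‖v_{s,j}‖² ≤ W for all s ∈ {0,1}^n. Let I = [n] × {0,1} × [m], let A be the F₀ × I matrix with A[w,(j,b,k)] = conj((v_{w,j})_k) if b = ¬w_j and 0 otherwise, let t ∈ ℂ^{F₀} have every entry 1/(3√W), and for x ∈ F₁ let Π̄(x) be the I × I diagonal 0/1 matrix with diagonal entry 1 at (j,b,k) iff b = ¬x_j. Let B_{G(x)} be the block matrix [[t, A],[0, Π̄(x)]] with columns indexed by {μ₀} ⊔ I. Then for each x ∈ F₁, the vector ψ ∈ ℂ^{{μ₀} ⊔ I} with ψ_{μ₀} = −3√W and ψ_{(j,b,k)} = (v_{x,j})_k if b = x_j (and 0 otherwise) satisfies B_{G(x)} ψ = 0 and |⟨0|ψ⟩|²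 ≥ (9/10)‖ψ‖², where |0⟩ is the standard basis vector at μ₀. -/
open scoped Matrix Classical

/-- Positive case of the spectral gap lemma for the canonical span program
graph: for `x ∈ f⁻¹(1)`, the true biadjacency matrix `B_{G(x)} = [[t, A], [0, Π̄(x)]]`
has the eigenvalue-zero eigenvector `ψ` with `ψ_{μ₀} = −3√W` and
`ψ_{(j,b,k)} = (v_{x,j})_k` for `b = x_j`, and `|⟨0|ψ⟩|² ≥ (9/10)‖ψ‖²`. -/
theorem canonical_span_program_true_spectral_gap
    {n : ℕ} (f : (Fin n → Bool) → Bool)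
    (m : ℕ) (hm : 0 < m) (W : ℝ) (hW : 1 ≤ W)
    (v : (Fin n → Bool) → Fin n → Fin m → ℂ)
    (hwitness : ∀ w x : Fin n → Bool, f w = false → f x = true →
      ∑ j ∈ Finset.univ.filter (fun j => w j ≠ x j), star (v w j) ⬝ᵥ v x j = 1)
    (hsize : ∀ s : Fin n → Bool, ∑ j, ∑ k, ‖v s j k‖ ^ 2 ≤ W)
    (x : Fin n → Bool) (hx : f x = true)
    (A : Matrix {w : Fin n → Bool // f w = false} (Fin n × Bool × Fin m) ℂ)
    (hA : ∀ w p, A w p = if p.2.1 = !(w.1 p.1) then star (v w.1 p.1 p.2.2) else 0)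
    (t : {w : Fin n → Bool // f w = false} → ℂ)
    (ht : ∀ w, t w = ((1 / (3 * Real.sqrt W) : ℝ) : ℂ))
    (BGx : Matrix ({w : Fin n → Bool // f w = false} ⊕ (Fin n × Bool × Fin m))
            (Unit ⊕ (Fin n × Bool × Fin m)) ℂ)
    (hB : BGx = Matrix.fromBlocks (Matrix.of fun w (_ : Unit) => t w) A 0
            (Matrix.diagonal fun p : Fin n × Bool × Fin m =>
              if p.2.1 = !(x p.1) then 1 else 0))
    (ψ : (Unit ⊕ (Fin n × Bool × Fin m)) → ℂ)
    (hψ : ψ = Sum.elim (fun _ => ((-(3 * Real.sqrt W) : ℝ) : ℂ))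
            (fun p => if p.2.1 = x p.1 then v x p.1 p.2.2 else 0)) :
    BGx *ᵥ ψ = 0 ∧ (9 / 10) * ∑ p, ‖ψ p‖ ^ 2 ≤ ‖ψ (Sum.inl ())‖ ^ 2 := by
  have hWpos : 0 < W := by linarith
  have hsqrt : Real.sqrt W ≠ 0 := (Real.sqrt_pos.mpr hWpos).ne'
  subst hB hψ
  refine ⟨?_, ?_⟩
  · rw [Matrix.fromBlocks_mulVec]
    ext (w | p)
    · have hA_mulVec : ∑ p : Fin n × Bool × Fin m,
          A w p * (if p.2.1 = x p.1 then v x p.1 p.2.2 else 0) = 1 := by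
        rw [← hwitness w.1 x w.2 hx, Finset.sum_filter, Fintype.sum_prod_type]
        refine Finset.sum_congr rfl fun j _ => ?_
        rw [Fintype.sum_prod_type]
        simp only [hA, Fintype.sum_bool]
        cases w.1 j <;> cases x j <;> simp [dotProduct]
      have ht_mul : t w * ((-(3 * Real.sqrt W) : ℝ) : ℂ) = -1 := by
        rw [ht, ← Complex.ofReal_mul]
        have : 1 / (3 * Real.sqrt W) * -(3 * Real.sqrt W) = -1 := by field_simp
        rw [this]
        simp
      simp only [Sum.elim_inl, Pi.add_apply, Pi.zero_apply, Matrix.mulVec, dotProduct,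
        Matrix.of_apply, Function.comp_apply, Sum.elim_inr, Finset.univ_unique,
        Finset.sum_const, Finset.card_singleton, one_smul]
      rw [hA_mulVec, ht_mul]
      ring
    · simp only [Sum.elim_inr, Pi.zero_apply, Matrix.zero_mulVec, zero_add,
        Matrix.mulVec_diagonal, Function.comp_apply]
      cases p.2.1 <;> cases x p.1 <;> simp
  · have hnorm : ∑ p : Fin n × Bool × Fin m,
        ‖if p.2.1 = x p.1 then v x p.1 p.2.2 else 0‖ ^ 2 = ∑ j, ∑ k, ‖v x j k‖ ^ 2 := by
      rw [Fintype.sum_prod_type]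
      refine Finset.sum_congr rfl fun j _ => ?_
      rw [Fintype.sum_prod_type]
      simp only [Fintype.sum_bool]
      cases x j <;> simp
    have hhead : ‖((-(3 * Real.sqrt W) : ℝ) : ℂ)‖ ^ 2 = 9 * W := by
      rw [Complex.norm_real, Real.norm_eq_abs, sq_abs, neg_sq, mul_pow, Real.sq_sqrt hWpos.le]
      norm_num
    rw [Fintype.sum_sum_type]
    simp only [Sum.elim_inl, Sum.elim_inr, Finset.univ_unique, Finset.sum_const,
      Finset.card_singleton, one_smul]
    rw [hnorm, hhead]
    linarith [hsize x]
end

section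
/- Let f : {0,1}^n → {0,1}, F₀ = f⁻¹(0), F₁ = f⁻¹(1), let m be a positive integer and W ≥ 1 a real number. Suppose vectors v_{s,j} ∈ ℂ^m are given for all s ∈ {0,1}^n, j ∈ [n], satisfying Σ_{j ∈ [n]} ‖v_{s,j}‖² ≤ W for all s ∈ {0,1}^n. Let I = [n] × {0,1} × [m], let A be the F₀ × I matrix with A[w,(j,b,k)] = conj((v_{w,j})_k) if b = ¬w_j and 0 otherwise, let t ∈ ℂ^{F₀} have every entry 1/(3√W), and for w ∈ F₀ let Π̄(w) be the I × I diagonal 0/1 matrix with diagonal entry 1 at (j,b,k) iff b = ¬w_j. Let B_{G'(w)} be the block matrix [[A],[Π̄(w)]] with rows indexed by F₀ ⊔ I and columns by I. Then for each w ∈ F₀, the vector ψ' ∈ ℂ^{F₀ ⊔ I} with ψ'_u = −1 if u = w and 0 for u ∈ F₀ \ {w}, and ψ'_{(j,b,k)} = (v_{w,j})_k if b = ¬w_j (and 0 otherwise), satisfies B_{G'(w)}* ψ' = 0 and |⟨t|ψ'⟩|² ≥ ‖ψ'‖² / (9W(W+1)), where ⟨t|ψ'⟩ pairs t with the F₀-block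 of ψ'. -/
open scoped Matrix Classical

/-- Negative case of the spectral gap lemma for the canonical span program
graph: for `w ∈ f⁻¹(0)`, the false biadjacency matrix `B_{G'(w)} = [[A], [Π̄(w)]]`
has the eigenvalue-zero left eigenvector `ψ'` with `ψ'_w = −1`,
`ψ'_{(j,b,k)} = (v_{w,j})_k` for `b = ¬w_j`, and
`|⟨t|ψ'⟩|² ≥ ‖ψ'‖²/(9W(W+1))`. -/
theorem canonical_span_program_false_spectral_gap
    {n : ℕ} (f : (Fin n → Bool) → Bool)
    (m : ℕ) (hm : 0 < m) (W : ℝ) (hW : 1 ≤ W)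
    (v : (Fin n → Bool) → Fin n → Fin m → ℂ)
    (hsize : ∀ s : Fin n → Bool, ∑ j, ∑ k, ‖v s j k‖ ^ 2 ≤ W)
    (w : Fin n → Bool) (hw : f w = false)
    (A : Matrix {u : Fin n → Bool // f u = false} (Fin n × Bool × Fin m) ℂ)
    (hA : ∀ u p, A u p = if p.2.1 = !(u.1 p.1) then star (v u.1 p.1 p.2.2) else 0)
    (t : {u : Fin n → Bool // f u = false} → ℂ)
    (ht : ∀ u, t u = ((1 / (3 * Real.sqrt W) : ℝ) : ℂ))
    (BGw : Matrix ({u : Fin n → Bool // f u = false} ⊕ (Fin n × Bool × Fin m))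
            (Fin n × Bool × Fin m) ℂ)
    (hB : BGw = Matrix.fromRows A
            (Matrix.diagonal fun p : Fin n × Bool × Fin m =>
              if p.2.1 = !(w p.1) then 1 else 0))
    (ψ' : ({u : Fin n → Bool // f u = false} ⊕ (Fin n × Bool × Fin m)) → ℂ)
    (hψ' : ψ' = Sum.elim (fun u => if u.1 = w then (-1 : ℂ) else 0)
            (fun p => if p.2.1 = !(w p.1) then v w p.1 p.2.2 else 0)) :
    BGwᴴ *ᵥ ψ' = 0 ∧
      (∑ p, ‖ψ' p‖ ^ 2) / (9 * W * (W + 1)) ≤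
        ‖star t ⬝ᵥ fun u => ψ' (Sum.inl u)‖ ^ 2 := by
  subst hB hψ'
  have hsub : ∀ u : {u : Fin n → Bool // f u = false}, u.1 = w ↔ u = ⟨w, hw⟩ :=
    fun u => ⟨fun h => Subtype.ext h, fun h => congrArg Subtype.val h⟩
  constructor
  · rw [Matrix.conjTranspose_fromRows_eq_fromCols_conjTranspose, Matrix.fromCols_mulVec_sumElim]
    funext p
    simp only [Pi.add_apply, Matrix.diagonal_conjTranspose, Matrix.mulVec_diagonal]
    simp only [Matrix.mulVec, dotProduct, Matrix.conjTranspose_apply, hsub, mul_ite, mul_zero,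
      Finset.sum_ite_eq', Finset.mem_univ, if_true, hA, Pi.star_apply]
    split_ifs <;> simp
  · have hW0 : 0 < W := by linarith
    have hoverlap : ‖star t ⬝ᵥ fun u : {u : Fin n → Bool // f u = false} =>
        if u.1 = w then (-1 : ℂ) else 0‖ ^ 2 = 1 / (9 * W) := by
      simp only [dotProduct, hsub, mul_ite, mul_zero, Finset.sum_ite_eq', Finset.mem_univ,
        if_true, Pi.star_apply, ht, mul_neg, mul_one, norm_neg, norm_star, Complex.norm_real,
        Real.norm_eq_abs, sq_abs]
      rw [div_pow, mul_pow, Real.sq_sqrt hW0.le]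
      norm_num
    have hnorm : ∑ u : {u : Fin n → Bool // f u = false},
        ‖if u.1 = w then (-1 : ℂ) else 0‖ ^ 2 = 1 := by
      simp [hsub, apply_ite (fun z : ℂ => ‖z‖ ^ 2)]
    have hedges : ∑ p : Fin n × Bool × Fin m,
        ‖if p.2.1 = !(w p.1) then v w p.1 p.2.2 else 0‖ ^ 2 ≤ W := by
      refine le_trans (le_of_eq ?_) (hsize w)
      simp only [Fintype.sum_prod_type]
      refine Finset.sum_congr rfl fun j _ => ?_
      cases w j <;> simp
    simp only [Fintype.sum_sum_type, Sum.elim_inl, Sum.elim_inr]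
    rw [hoverlap, hnorm, div_le_div_iff₀ (by positivity) (by positivity)]
    nlinarith
end
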